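/- arXiv:1509.02717 — 3 statements merged into one kernel-verified Lean document; each statement's English description precedes it below -/
import Mathlib

section
/- Let G_a, G_b, G_c be nontrivial cyclic groups. Then the free product G = G_a*G_b*G_c is finitely annihilated: for every nontrivial element g of G there exists a proper normal subgroup N of G of finite index with g ∈ N (i.e., g becomes trivial in the nontrivial finite quotient G/N). -/
open Monoid

namespace SW

/-- Triple product. -/
def T (u v w : Fin 3 → ℝ) : ℝ :=
  u 0 * (v 1 * w 2 - v 2 * w 1) + u 1 * (v 2 * w 0 - v 0 * w 2) + u 2 * (v 0 * w 1 - v 1 * w 0)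

abbrev E3 := Fin 3 → ℝ

lemma T_diff {u v w : Fin 3 → E3 → ℝ} {x : E3}
    (hu : ∀ a, DifferentiableAt ℝ (u a) x) (hv : ∀ a, DifferentiableAt ℝ (v a) x)
    (hw : ∀ a, DifferentiableAt ℝ (w a) x) (e : E3) :
    DifferentiableAt ℝ (fun y => T (fun a => u a y) (fun a => v a y) (fun a => w a y)) x ∧
    fderiv ℝ (fun y => T (fun a => u a y) (fun a => v a y) (fun a => w a y)) x e =
      T (fun a => fderiv ℝ (u a) x e) (fun a => v a x) (fun a => w a x) +
      T (fun a => u a x) (fun a => fderiv ℝ (v a) x e) (fun a => w a x) +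
      T (fun a => u a x) (fun a => v a x) (fun a => fderiv ℝ (w a) x e) := by
  have hu' := fun a => (hu a).hasFDerivAt
  have hv' := fun a => (hv a).hasFDerivAt
  have hw' := fun a => (hw a).hasFDerivAt
  have key := (((hu' 0).mul (((hv' 1).mul (hw' 2)).sub ((hv' 2).mul (hw' 1)))).add
    ((hu' 1).mul (((hv' 2).mul (hw' 0)).sub ((hv' 0).mul (hw' 2))))).add
    ((hu' 2).mul (((hv' 0).mul (hw' 1)).sub ((hv' 1).mul (hw' 0))))
  have key2 : HasFDerivAt (fun y => T (fun a => u a y) (fun a => v a y) (fun a => w a y)) _ x := key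
  refine ⟨key2.differentiableAt, ?_⟩
  rw [key2.fderiv]
  simp [T]
  ring

lemma T_zero_of_perp (f u v w : Fin 3 → ℝ) (h1 : f 0 ^ 2 + f 1 ^ 2 + f 2 ^ 2 = 1)
    (hu : f 0 * u 0 + f 1 * u 1 + f 2 * u 2 = 0)
    (hv : f 0 * v 0 + f 1 * v 1 + f 2 * v 2 = 0)
    (hw : f 0 * w 0 + f 1 * w 1 + f 2 * w 2 = 0) : T u v w = 0 := by
  have e0 : f 0 * T u v w = 0 := by
    simp only [T]
    linear_combination (v 1 * w 2 - v 2 * w 1) * hu + (w 1 * u 2 - w 2 * u 1) * hv +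
      (u 1 * v 2 - u 2 * v 1) * hw
  have e1 : f 1 * T u v w = 0 := by
    simp only [T]
    linear_combination (v 2 * w 0 - v 0 * w 2) * hu + (w 2 * u 0 - w 0 * u 2) * hv +
      (u 2 * v 0 - u 0 * v 2) * hw
  have e2 : f 2 * T u v w = 0 := by
    simp only [T]
    linear_combination (v 0 * w 1 - v 1 * w 0) * hu + (w 0 * u 1 - w 1 * u 0) * hv +
      (u 0 * v 1 - u 1 * v 0) * hw
  linear_combination (-T u v w) * h1 + f 0 * e0 + f 1 * e1 + f 2 * e2

lemma perp_of_unit (f : Fin 3 → E3 → ℝ) (hd : ∀ a x, DifferentiableAt ℝ (f a) x)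
    (h1 : ∀ x, f 0 x ^ 2 + f 1 x ^ 2 + f 2 x ^ 2 = 1) (x e : E3) :
    f 0 x * fderiv ℝ (f 0) x e + f 1 x * fderiv ℝ (f 1) x e + f 2 x * fderiv ℝ (f 2) x e = 0 := by
  have k := ((((hd 0 x).hasFDerivAt.mul (hd 0 x).hasFDerivAt).add
    ((hd 1 x).hasFDerivAt.mul (hd 1 x).hasFDerivAt)).add
    ((hd 2 x).hasFDerivAt.mul (hd 2 x).hasFDerivAt))
  have h2 : (f 0 * f 0 + f 1 * f 1 + f 2 * f 2) = fun _ => (1:ℝ) := by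
    funext y
    simp only [Pi.add_apply, Pi.mul_apply]
    linear_combination h1 y
  rw [h2] at k
  have := k.unique (hasFDerivAt_const (1:ℝ) x)
  have := congrArg (fun L => L e) this
  simp at this
  linarith

/-- Face integral over a box of a partial derivative. -/
lemma face_int (g : (Fin 2 → ℝ) → ℝ) (hg : ContDiff ℝ 1 g) (α β : ℝ) (h0 : 0 ≤ α) (hb : 0 ≤ β)
    (hα : ∀ t, g ![α, t] = g ![α, 0]) (hz : ∀ t, g ![0, t] = g ![0, 0]) :
    ∫ x in Set.Icc (![0, 0] : Fin 2 → ℝ) ![α, β], fderiv ℝ g x (Pi.single 0 1) =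
      β * (g ![α, 0] - g ![0, 0]) := by
  have hle : (![0, 0] : Fin 2 → ℝ) ≤ ![α, β] := by
    intro i; fin_cases i <;> simpa
  have cd := (hg.continuous_fderiv (by norm_num))
  have := MeasureTheory.integral_divergence_of_hasFDerivAt_off_countable' (n := 1)
    (![0, 0] : Fin 2 → ℝ) ![α, β] hle ![g, fun _ => 0] ![fun x => fderiv ℝ g x, fun _ => 0] ∅
    Set.countable_empty
    (by intro i; fin_cases i
        · exact hg.continuous.continuousOn
        · exact continuousOn_const)
    (by intro x _ i; fin_cases i
        · exact (hg.differentiable (by norm_num) x).hasFDerivAt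
        · exact hasFDerivAt_const _ _)
    (by
      apply Continuous.integrableOn_Icc
      simp only [Nat.reduceAdd, Fin.sum_univ_two]
      exact (cd.clm_apply continuous_const).add continuous_const)
  simp only [Nat.reduceAdd, Fin.sum_univ_two] at this
  simp at this
  rw [this]
  have e1 : ∀ x : Fin 1 → ℝ, g (Fin.cons α x) = g ![α, 0] := fun x => by
    rw [← hα (x 0)]; congr 1; funext i; fin_cases i <;> rfl
  have e2 : ∀ x : Fin 1 → ℝ, g (Fin.cons 0 x) = g ![0, 0] := fun x => by
    rw [← hz (x 0)]; congr 1; funext i; fin_cases i <;> rfl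
  simp only [e1, e2]
  simp [MeasureTheory.setIntegral_const, MeasureTheory.measureReal_def, Real.volume_Icc_pi]
  rw [ENNReal.toReal_ofReal hb]
  ring


lemma degree (f : Fin 3 → E3 → ℝ) (hf : ∀ a, ContDiff ℝ 3 (f a))
    (h1 : ∀ x, f 0 x ^ 2 + f 1 x ^ 2 + f 2 x ^ 2 = 1)
    (hper : ∀ a x, f a (x + Pi.single 2 (2 * Real.pi)) = f a x)
    (hpole : ∀ a x t, (x 1 = 0 ∨ x 1 = Real.pi) → f a (x + Pi.single 2 t) = f a x)
    (hrot0 : ∀ x t, (x 0 = 0 ∨ x 0 = Real.pi) →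
      f 0 (x + Pi.single 2 t) = Real.cos t * f 0 x - Real.sin t * f 1 x)
    (hrot1 : ∀ x t, (x 0 = 0 ∨ x 0 = Real.pi) →
      f 1 (x + Pi.single 2 t) = Real.sin t * f 0 x + Real.cos t * f 1 x)
    (hrot2 : ∀ x t, (x 0 = 0 ∨ x 0 = Real.pi) → f 2 (x + Pi.single 2 t) = f 2 x) :
    f 2 ![0, Real.pi, 0] - f 2 ![0, 0, 0] = f 2 ![Real.pi, Real.pi, 0] - f 2 ![Real.pi, 0, 0] := by
  have hd : ∀ a x, DifferentiableAt ℝ (f a) x := fun a x => (hf a).differentiable (by norm_num) x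
  let D : Fin 3 → Fin 3 → E3 → ℝ := fun i a y => fderiv ℝ (f a) y (Pi.single i 1)
  have hDc : ∀ i a, ContDiff ℝ 2 (D i a) := fun i a =>
    ((hf a).fderiv_right (m := 2) (by norm_num)).clm_apply contDiff_const
  have hDd : ∀ i a x, DifferentiableAt ℝ (D i a) x := fun i a x =>
    (hDc i a).differentiable (by norm_num) x
  have hsymm : ∀ i j a x, fderiv ℝ (D i a) x (Pi.single j 1) = fderiv ℝ (D j a) x (Pi.single i 1) := by
    intro i j a x
    have hdd : DifferentiableAt ℝ (fderiv ℝ (f a)) x :=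
      ((hf a).fderiv_right (m := 2) (by norm_num)).differentiable (by norm_num) x
    have e : ∀ i v, fderiv ℝ (D i a) x v = fderiv ℝ (fderiv ℝ (f a)) x v (Pi.single i 1) := by
      intro i v
      simp only [D]
      rw [fderiv_clm_apply hdd (differentiableAt_const _)]
      simp
    rw [e, e]
    have := ((hf a).contDiffAt (x := x)).isSymmSndFDerivAt (by simp; norm_num)
    exact this _ _
  have hperp : ∀ i x, f 0 x * D i 0 x + f 1 x * D i 1 x + f 2 x * D i 2 x = 0 :=
    fun i x => perp_of_unit f hd h1 x _
  let J' : Fin 3 → Fin 3 → E3 → ℝ := fun i j y =>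
    T (fun a => f a y) (fun a => D i a y) (fun a => D j a y)
  have hJ'c : ∀ i j, ContDiff ℝ 2 (J' i j) := by
    intro i j
    have hf2 : ∀ a, ContDiff ℝ 2 (f a) := fun a => (hf a).of_le (by norm_num)
    simp only [J', T]
    have := hDc i
    have := hDc j
    fun_prop
  let J : Fin 3 → E3 → ℝ := ![J' 1 2, J' 2 0, J' 0 1]
  have hJc : ∀ i, ContDiff ℝ 2 (J i) := by
    intro i; fin_cases i <;> exact hJ'c _ _
  have hdiv : ∀ x, ∑ i, fderiv ℝ (J i) x (Pi.single i 1) = 0 := by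
    intro x
    rw [Fin.sum_univ_three]
    have e0 := (T_diff (fun a => hd a x) (fun a => hDd 1 a x) (fun a => hDd 2 a x) (Pi.single 0 1)).2
    have e1 := (T_diff (fun a => hd a x) (fun a => hDd 2 a x) (fun a => hDd 0 a x) (Pi.single 1 1)).2
    have e2 := (T_diff (fun a => hd a x) (fun a => hDd 0 a x) (fun a => hDd 1 a x) (Pi.single 2 1)).2
    have z := T_zero_of_perp (fun a => f a x) (fun a => D 0 a x) (fun a => D 1 a x)
      (fun a => D 2 a x) (h1 x) (hperp 0 x) (hperp 1 x) (hperp 2 x)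
    change fderiv ℝ (J 0) x (Pi.single 0 1) = _ at e0
    change fderiv ℝ (J 1) x (Pi.single 1 1) = _ at e1
    change fderiv ℝ (J 2) x (Pi.single 2 1) = _ at e2
    rw [e0, e1, e2]
    simp only [hsymm 1 0, hsymm 2 0, hsymm 2 1]
    change T (fun a => D 0 a x) _ _ + _ + _ + (T (fun a => D 1 a x) _ _ + _ + _) +
      (T (fun a => D 2 a x) _ _ + _ + _) = 0
    simp only [T] at z ⊢
    linear_combination 3 * z
  have hpi := Real.pi_pos
  have hle : (![0, 0, 0] : E3) ≤ ![Real.pi, Real.pi, 2 * Real.pi] := by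
    intro i; fin_cases i <;> simp <;> positivity
  have main := MeasureTheory.integral_divergence_of_hasFDerivAt_off_countable' (n := 2)
    (![0, 0, 0] : E3) ![Real.pi, Real.pi, 2 * Real.pi] hle J (fun i => fderiv ℝ (J i)) ∅
    Set.countable_empty (fun i => (hJc i).continuous.continuousOn)
    (fun x _ i => ((hJc i).differentiable (by norm_num) x).hasFDerivAt)
    (by
      have : (fun x : E3 => ∑ i, fderiv ℝ (J i) x (Pi.single i 1)) = fun _ => 0 := funext hdiv
      rw [this]
      exact Continuous.integrableOn_Icc continuous_const)
  have hdiv' : (fun x : E3 => ∑ i, fderiv ℝ (J i) x (Pi.single i 1)) = fun _ => 0 := funext hdiv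
  rw [hdiv'] at main
  have hD2 : ∀ a x (b c d : ℝ), (∀ t, f a (x + Pi.single 2 t) = b + Real.cos t * c + Real.sin t * d) →
      D 2 a x = d := by
    intro a x b c d h
    have k1 : HasDerivAt (fun t : ℝ => f a (x + t • (Pi.single 2 1 : E3))) (D 2 a x) 0 := by
      have hx : HasFDerivAt (f a) (fderiv ℝ (f a) x) (x + (0:ℝ) • (Pi.single 2 1 : E3)) := by
        simpa using (hd a x).hasFDerivAt
      have hl : HasDerivAt (fun t : ℝ => x + t • (Pi.single 2 1 : E3)) (Pi.single 2 1) 0 := by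
        simpa using ((hasDerivAt_id (0:ℝ)).smul_const (Pi.single 2 1 : E3)).const_add x
      exact hx.comp_hasDerivAt (0:ℝ) hl
    have k2 : HasDerivAt (fun t : ℝ => b + Real.cos t * c + Real.sin t * d)
        (-Real.sin 0 * c + Real.cos 0 * d) 0 :=
      (((Real.hasDerivAt_cos 0).mul_const c).const_add b).add ((Real.hasDerivAt_sin 0).mul_const d)
    have : (fun t : ℝ => f a (x + t • (Pi.single 2 1 : E3))) =
        fun t : ℝ => b + Real.cos t * c + Real.sin t * d := by
      funext t
      rw [← h t]
      congr 2
      ext i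
      by_cases hi : i = 2 <;> simp [hi]
    rw [this] at k1
    have := k1.unique k2
    simpa using this
  have hJ1 : ∀ x : E3, (x 1 = 0 ∨ x 1 = Real.pi) → J 1 x = 0 := by
    intro x hx
    have z : ∀ a, D 2 a x = 0 := fun a =>
      hD2 a x (f a x) 0 0 fun t => by rw [hpole a x t hx]; ring
    change J' 2 0 x = 0
    simp [J', T, z]
  have hDper : ∀ i a x, D i a (x + Pi.single 2 (2 * Real.pi)) = D i a x := by
    intro i a x
    simp only [D]
    rw [← fderiv_comp_add_right]
    congr 2
    funext y
    exact hper a y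
  have hJ2 : ∀ x : E3, J 2 (x + Pi.single 2 (2 * Real.pi)) = J 2 x := by
    intro x
    change J' 0 1 _ = J' 0 1 _
    simp only [J', hDper, hper]
  have hJ0 : ∀ x : E3, (x 0 = 0 ∨ x 0 = Real.pi) → J 0 x = - D 1 2 x := by
    intro x hx
    have z0 : D 2 0 x = - f 1 x := hD2 0 x 0 (f 0 x) _ fun t => by rw [hrot0 x t hx]; ring
    have z1 : D 2 1 x = f 0 x := hD2 1 x 0 (f 1 x) _ fun t => by rw [hrot1 x t hx]; ring
    have z2 : D 2 2 x = 0 := hD2 2 x (f 2 x) 0 _ fun t => by rw [hrot2 x t hx]; ring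
    have hp := hperp 1 x
    have h1x := h1 x
    change J' 1 2 x = _
    simp only [J', T, z0, z1, z2]
    linear_combination  f 2 x * hp - D 1 2 x * h1x
  simp only [Nat.reduceAdd, Fin.sum_univ_three] at main
  have m1a : ∀ y : Fin 2 → ℝ, J 1 (Fin.insertNth (α := fun _ => ℝ) 1 Real.pi y) = 0 :=
    fun y => hJ1 _ (Or.inr (by simp))
  have m1b : ∀ y : Fin 2 → ℝ, J 1 (Fin.insertNth (α := fun _ => ℝ) 1 0 y) = 0 :=
    fun y => hJ1 _ (Or.inl (by simp))
  have m2 : ∀ y : Fin 2 → ℝ, J 2 (Fin.insertNth (α := fun _ => ℝ) 2 (2 * Real.pi) y) =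
      J 2 (Fin.insertNth (α := fun _ => ℝ) 2 0 y) := fun y => by
    rw [← hJ2 (Fin.insertNth (α := fun _ => ℝ) 2 0 y)]
    congr 1
    funext i
    fin_cases i
    · have := Fin.insertNth_apply_succAbove (α := fun _ => ℝ) (2 : Fin 3) (2 * Real.pi) y 0
      have h2 := Fin.insertNth_apply_succAbove (α := fun _ => ℝ) (2 : Fin 3) 0 y 0
      rw [Pi.add_apply, Pi.single_eq_of_ne (by decide), add_zero]
      exact this.trans h2.symm
    · have := Fin.insertNth_apply_succAbove (α := fun _ => ℝ) (2 : Fin 3) (2 * Real.pi) y 1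
      have h2 := Fin.insertNth_apply_succAbove (α := fun _ => ℝ) (2 : Fin 3) 0 y 1
      rw [Pi.add_apply, Pi.single_eq_of_ne (by decide), add_zero]
      exact this.trans h2.symm
    · simp
  have face : ∀ s : ℝ, (s = 0 ∨ s = Real.pi) →
      ∫ y in Set.Icc (![0, 0] : Fin 2 → ℝ) ![Real.pi, 2 * Real.pi],
        J 0 (Fin.insertNth (α := fun _ => ℝ) 0 s y) =
      - (2 * Real.pi * (f 2 ![s, Real.pi, 0] - f 2 ![s, 0, 0])) := by
    intro s hs
    let g : (Fin 2 → ℝ) → ℝ := fun y => f 2 ![s, y 0, y 1]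
    let L : (Fin 2 → ℝ) → E3 := fun y => ![s, y 0, y 1]
    have hL : ContDiff ℝ 1 L := by
      rw [contDiff_pi]
      intro i; fin_cases i <;> simp [L] <;> fun_prop
    have hLd : ∀ y, fderiv ℝ L y (Pi.single 0 1) = Pi.single 1 1 := by
      intro y
      have hl : HasFDerivAt L (ContinuousLinearMap.pi (![0,
          (ContinuousLinearMap.proj (R := ℝ) (φ := fun _ : Fin 2 => ℝ) 0),
          (ContinuousLinearMap.proj (R := ℝ) (φ := fun _ : Fin 2 => ℝ) 1)] :
            Fin 3 → (Fin 2 → ℝ) →L[ℝ] ℝ)) y := by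
        rw [hasFDerivAt_pi']
        intro i
        fin_cases i
        · exact hasFDerivAt_const _ _
        · exact (ContinuousLinearMap.proj (R := ℝ) (φ := fun _ : Fin 2 => ℝ) 0).hasFDerivAt
        · exact (ContinuousLinearMap.proj (R := ℝ) (φ := fun _ : Fin 2 => ℝ) 1).hasFDerivAt
      rw [hl.fderiv]
      funext i; fin_cases i <;> simp
    have hg : ContDiff ℝ 1 g := ((hf 2).of_le (by norm_num)).comp hL
    have hgd : ∀ y, fderiv ℝ g y (Pi.single 0 1) = D 1 2 (L y) := by
      intro y
      have : fderiv ℝ g y = _ := fderiv_comp y (hd 2 (L y)) (hL.differentiable (by norm_num) y)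
      rw [this]
      change fderiv ℝ (f 2) (L y) (fderiv ℝ L y (Pi.single 0 1)) = _
      rw [hLd]
    have := face_int g hg Real.pi (2 * Real.pi) hpi.le (by positivity) (by
        intro t
        have := hpole 2 ![s, Real.pi, 0] t (by simp)
        simp only [g]
        refine Eq.trans ?_ this
        congr 1
        funext i; fin_cases i <;> simp) (by
        intro t
        have := hpole 2 ![s, 0, 0] t (by simp)
        simp only [g]
        refine Eq.trans ?_ this
        congr 1
        funext i; fin_cases i <;> simp)
    rw [show (fun y => J 0 (Fin.insertNth (α := fun _ => ℝ) 0 s y)) =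
      fun y => - fderiv ℝ g y (Pi.single 0 1) from ?_]
    · rw [MeasureTheory.integral_neg, this]
      simp [g]
    · funext y
      rw [hgd, hJ0 _ (by simpa using hs)]
      congr 2
      funext i; fin_cases i <;> simp [L] <;> rfl
  have c1 : (![0, 0, 0] : E3) ∘ Fin.succAbove 0 = ![0, 0] := by
    funext i; fin_cases i <;> rfl
  have c2 : (![Real.pi, Real.pi, 2 * Real.pi] : E3) ∘ Fin.succAbove 0 = ![Real.pi, 2 * Real.pi] := by
    funext i; fin_cases i <;> rfl
  have f0 := face 0 (Or.inl rfl)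
  have f1 := face Real.pi (Or.inr rfl)
  rw [c1, c2] at main
  have b0 : (![Real.pi, Real.pi, 2 * Real.pi] : E3) 0 = Real.pi := rfl
  have b1 : (![Real.pi, Real.pi, 2 * Real.pi] : E3) 1 = Real.pi := rfl
  have b2 : (![Real.pi, Real.pi, 2 * Real.pi] : E3) 2 = 2 * Real.pi := rfl
  have a0 : (![0, 0, 0] : E3) 0 = 0 := rfl
  have a1 : (![0, 0, 0] : E3) 1 = 0 := rfl
  have a2 : (![0, 0, 0] : E3) 2 = 0 := rfl
  rw [b0, b1, b2, a0, a1, a2, f0, f1] at main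
  simp only [m1a, m1b, m2] at main
  simp only [MeasureTheory.integral_zero, sub_self, add_zero] at main
  have : 2 * Real.pi * ((f 2 ![0, Real.pi, 0] - f 2 ![0, 0, 0]) -
    (f 2 ![Real.pi, Real.pi, 0] - f 2 ![Real.pi, 0, 0])) = 0 := by linarith
  have := (mul_eq_zero.mp this).resolve_left (by positivity)
  linarith




lemma jacobson_int : IsJacobsonRing ℤ := by
  rw [isJacobsonRing_iff_prime_eq]
  intro P hP
  by_cases h : P = ⊥
  · subst h
    rw [eq_bot_iff]
    intro z hz
    by_contra hz0
    have hz0 : z ≠ 0 := hz0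
    obtain ⟨p, hp1, hp⟩ := Nat.exists_infinite_primes (z.natAbs + 1)
    rw [Ideal.jacobson, Submodule.mem_sInf] at hz
    have hm : (Ideal.span {(p : ℤ)}).IsMaximal :=
      PrincipalIdealRing.isMaximal_of_irreducible (Nat.prime_iff_prime_int.mp hp).irreducible
    have := hz _ ⟨bot_le, hm⟩
    rw [Ideal.mem_span_singleton] at this
    have h2 := Int.natAbs_dvd_natAbs.mpr this
    have h3 := Nat.le_of_dvd (Int.natAbs_pos.mpr hz0) h2
    simp at h3
    omega
  · have := hP.isMaximal h
    exact Ideal.jacobson_eq_self_of_isMaximal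

lemma finite_field_of_fg (K : Type*) [Field K] [Algebra.FiniteType ℤ K] : Finite K := by
  have := jacobson_int
  have hfin : Module.Finite ℤ K := finite_of_finite_type_of_isJacobsonRing ℤ K
  have hni : ¬ Function.Injective (algebraMap ℤ K) := by
    intro hinj
    have : Algebra.IsIntegral ℤ K := inferInstance
    exact Int.not_isField (isField_of_isIntegral_of_isField hinj (Field.toIsField K))
  obtain ⟨p, hp⟩ := CharP.exists K
  have hp0 : p ≠ 0 := by
    rintro rfl
    have := CharP.charP_to_charZero K
    exact hni (algebraMap ℤ K).injective_int
  have : NeZero p := ⟨hp0⟩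
  let := ZMod.algebra K p
  have : Module.Finite (ZMod p) K := Module.Finite.of_restrictScalars_finite ℤ (ZMod p) K
  exact Module.finite_of_finite (ZMod p)

lemma finite_field_of_surj {R K : Type*} [CommRing R] [Field K] [Algebra.FiniteType ℤ R]
    (f : R →+* K) (hf : Function.Surjective f) : Finite K := by
  have : Algebra.FiniteType ℤ K := Algebra.FiniteType.of_surjective f.toIntAlgHom hf
  exact finite_field_of_fg K

lemma malcev {G : Type*} [Group G] (S : Finset G) (hS : Subgroup.closure (S : Set G) = ⊤)
    {n : Type*} [Fintype n] [DecidableEq n] {K : Type*} [Field K]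
    (ρ : G →* Matrix n n K) (x : G) (hx : ρ x ≠ 1) :
    ∃ N : Subgroup G, N.Normal ∧ N.FiniteIndex ∧ N ≠ ⊤ ∧ ∀ g, ρ g = 1 → g ∈ N := by
  classical
  let ents : Set K := ⋃ s ∈ S, Set.range (fun ij : n × n => ρ s ij.1 ij.2) ∪
    Set.range (fun ij : n × n => ρ s⁻¹ ij.1 ij.2)
  have hfin : ents.Finite := by
    apply Set.Finite.biUnion S.finite_toSet
    intro s _
    exact (Set.finite_range _).union (Set.finite_range _)
  let R := Algebra.adjoin ℤ ents
  have hmem : ∀ g : G, ∀ i j, ρ g i j ∈ R := by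
    intro g
    have hg : g ∈ Subgroup.closure (S : Set G) := by rw [hS]; trivial
    induction hg using Subgroup.closure_induction'' with
    | mem s hs =>
      intro i j
      apply Algebra.subset_adjoin
      simp only [ents, Set.mem_iUnion]
      exact ⟨s, hs, Or.inl ⟨(i, j), rfl⟩⟩
    | inv_mem s hs =>
      intro i j
      apply Algebra.subset_adjoin
      simp only [ents, Set.mem_iUnion]
      exact ⟨s, hs, Or.inr ⟨(i, j), rfl⟩⟩
    | one =>
      intro i j
      rw [map_one, Matrix.one_apply]
      split_ifs
      · exact one_mem _
      · exact zero_mem _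
    | mul a b _ _ ha hb =>
      intro i j
      rw [map_mul, Matrix.mul_apply]
      exact sum_mem fun k _ => mul_mem (ha _ _) (hb _ _)
  have : Algebra.FiniteType ℤ R := by
    rw [← Subalgebra.fg_iff_finiteType]
    exact ⟨hfin.toFinset, by simp [R]⟩
  let ρR : G →* Matrix n n R :=
    { toFun := fun g => Matrix.of fun i j => ⟨ρ g i j, hmem g i j⟩
      map_one' := by
        ext i j
        simp [Matrix.one_apply]
        split_ifs <;> simp
      map_mul' := by
        intro a b
        ext i j
        simp [Matrix.mul_apply] }
  have : ∃ i j, ρ x i j - (1 : Matrix n n K) i j ≠ 0 := by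
    by_contra! h
    exact hx (by ext i j; exact sub_eq_zero.mp (h i j))
  obtain ⟨i, j, hij⟩ := this
  let r : R := ρR x i j - (1 : Matrix n n R) i j
  have hr : r ≠ 0 := by
    intro h
    apply hij
    have := congrArg (Subtype.val) h
    change ρ x i j - ((1 : Matrix n n R) i j).val = 0 at this
    simp [Matrix.one_apply] at this ⊢
    split_ifs at this ⊢ <;> simpa using this
  have hZ := jacobson_int
  have hJ : IsJacobsonRing R := isJacobsonRing_of_finiteType (A := ℤ)
  have hjac : (⊥ : Ideal R).jacobson = ⊥ := by
    apply hJ.out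
    exact Ideal.IsPrime.isRadical Ideal.isPrime_bot
  have : ∃ m : Ideal R, m.IsMaximal ∧ r ∉ m := by
    by_contra! h
    apply hr
    have : r ∈ (⊥ : Ideal R).jacobson := by
      rw [Ideal.jacobson, Submodule.mem_sInf]
      intro m hm
      exact h m hm.2
    rwa [hjac] at this
  obtain ⟨m, hm, hrm⟩ := this
  let : Field (R ⧸ m) := Ideal.Quotient.field m
  have : Finite (R ⧸ m) := finite_field_of_surj (Ideal.Quotient.mk m) Ideal.Quotient.mk_surjective
  let φ : G →* Matrix n n (R ⧸ m) := (((Ideal.Quotient.mk m).mapMatrix (m := n)).toMonoidHom).comp ρR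
  let ψ := φ.toHomUnits
  refine ⟨ψ.ker, inferInstance, ?_, ?_, ?_⟩
  · have : Finite (Matrix n n (R ⧸ m)) := inferInstanceAs (Finite (n → n → _))
    infer_instance
  · intro h
    have : x ∈ ψ.ker := by rw [h]; trivial
    rw [MonoidHom.mem_ker] at this
    have := congrArg (fun u : (Matrix n n (R ⧸ m))ˣ => u.val i j) this
    simp only [ψ, MonoidHom.coe_toHomUnits] at this
    apply hrm
    rw [← Ideal.Quotient.eq_zero_iff_mem]
    simp only [φ] at this
    simp [Matrix.one_apply] at this
    simp only [r, map_sub, this, Matrix.one_apply]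
    split_ifs <;> simp
  · intro g hg
    rw [MonoidHom.mem_ker]
    have h1 : ρR g = 1 := by
      ext i j
      simp [ρR, hg, Matrix.one_apply]
      split_ifs <;> simp
    ext i j
    simp [ψ, φ, h1, Matrix.one_apply]


open Quaternion in
/-- The unit quaternion with half-angle `t` and axis with spherical coordinates `θ, φ`. -/
noncomputable def Uq (t θ φ : ℝ) : Quaternion ℝ :=
  ⟨Real.cos t, Real.sin t * Real.sin θ * Real.cos φ, Real.sin t * Real.sin θ * Real.sin φ,
    Real.sin t * Real.cos θ⟩

@[simp] lemma Uq_re (t θ φ : ℝ) : (Uq t θ φ).re = Real.cos t := rfl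
@[simp] lemma Uq_imI (t θ φ : ℝ) : (Uq t θ φ).imI = Real.sin t * Real.sin θ * Real.cos φ := rfl
@[simp] lemma Uq_imJ (t θ φ : ℝ) : (Uq t θ φ).imJ = Real.sin t * Real.sin θ * Real.sin φ := rfl
@[simp] lemma Uq_imK (t θ φ : ℝ) : (Uq t θ φ).imK = Real.sin t * Real.cos θ := rfl

lemma Uq_star_mul (t θ φ : ℝ) : star (Uq t θ φ) * Uq t θ φ = 1 := by
  have h1 := Real.sin_sq_add_cos_sq t
  have h2 := Real.sin_sq_add_cos_sq θ
  have h3 := Real.sin_sq_add_cos_sq φ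
  apply Quaternion.ext
  · change _ = (1 : ℝ)
    simp
    linear_combination h1 + Real.sin t ^ 2 * h2 + Real.sin t ^ 2 * Real.sin θ ^ 2 * h3
  all_goals (change _ = (0 : ℝ); simp; try ring)

lemma Uq_mul_star (t θ φ : ℝ) : Uq t θ φ * star (Uq t θ φ) = 1 := by
  have h1 := Real.sin_sq_add_cos_sq t
  have h2 := Real.sin_sq_add_cos_sq θ
  have h3 := Real.sin_sq_add_cos_sq φ
  apply Quaternion.ext
  · change _ = (1 : ℝ)
    simp
    linear_combination h1 + Real.sin t ^ 2 * h2 + Real.sin t ^ 2 * Real.sin θ ^ 2 * h3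
  all_goals (change _ = (0 : ℝ); simp; try ring)

noncomputable abbrev UH := unitary (Quaternion ℝ)

noncomputable def U (t θ φ : ℝ) : UH :=
  ⟨Uq t θ φ, Unitary.mem_iff.mpr ⟨Uq_star_mul t θ φ, Uq_mul_star t θ φ⟩⟩

@[simp] lemma U_coe (t θ φ : ℝ) : (U t θ φ : Quaternion ℝ) = Uq t θ φ := rfl

lemma U_add (s t θ φ : ℝ) : U (s + t) θ φ = U s θ φ * U t θ φ := by
  have h2 := Real.sin_sq_add_cos_sq θ
  have h3 := Real.sin_sq_add_cos_sq φ
  apply Subtype.ext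
  apply Quaternion.ext
  · simp [Real.cos_add]
    linear_combination (Real.sin s * Real.sin t) * h2 +
      Real.sin s * Real.sin t * Real.sin θ ^ 2 * h3
  all_goals (simp [Real.sin_add]; try ring)

lemma U_zero (θ φ : ℝ) : U 0 θ φ = 1 := by
  apply Subtype.ext
  apply Quaternion.ext
  · change _ = (1 : ℝ)
    simp
  all_goals (change _ = (0 : ℝ); simp)

lemma U_pow (t θ φ : ℝ) (n : ℕ) : U t θ φ ^ n = U (n * t) θ φ := by
  induction n with
  | zero => simp [U_zero]
  | succ n ih =>
    rw [pow_succ, ih, ← U_add]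
    congr 1
    push_cast
    ring

/-- rotations around the third axis -/
noncomputable def E : Multiplicative ℝ →* UH where
  toFun t := U t.toAdd 0 0
  map_one' := U_zero 0 0
  map_mul' s t := U_add s.toAdd t.toAdd 0 0

lemma E_apply (t : ℝ) : E (Multiplicative.ofAdd t) = U t 0 0 := rfl

lemma U_pi (t : ℝ) : U t Real.pi 0 = E (Multiplicative.ofAdd (-t)) := by
  rw [E_apply]
  apply Subtype.ext
  apply Quaternion.ext <;> simp

lemma word_smooth (A : Fin 3 → E3 → UH)
    (hA : ∀ i, ContDiff ℝ 3 (fun x => (A i x : Quaternion ℝ).re) ∧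
      ContDiff ℝ 3 (fun x => (A i x : Quaternion ℝ).imI) ∧
      ContDiff ℝ 3 (fun x => (A i x : Quaternion ℝ).imJ) ∧
      ContDiff ℝ 3 (fun x => (A i x : Quaternion ℝ).imK)) (w : FreeGroup (Fin 3)) :
    ContDiff ℝ 3 (fun x => (FreeGroup.lift (fun i => A i x) w : Quaternion ℝ).re) ∧
      ContDiff ℝ 3 (fun x => (FreeGroup.lift (fun i => A i x) w : Quaternion ℝ).imI) ∧
      ContDiff ℝ 3 (fun x => (FreeGroup.lift (fun i => A i x) w : Quaternion ℝ).imJ) ∧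
      ContDiff ℝ 3 (fun x => (FreeGroup.lift (fun i => A i x) w : Quaternion ℝ).imK) := by
  induction w using FreeGroup.induction_on with
  | C1 => simp [contDiff_const]
  | of i => simpa using hA i
  | inv_of i _ =>
    obtain ⟨h0, h1, h2, h3⟩ := hA i
    simp only [map_inv, FreeGroup.lift_apply_of, ← Unitary.star_eq_inv, Unitary.coe_star,
      Quaternion.re_star, Quaternion.imI_star, Quaternion.imJ_star, Quaternion.imK_star]
    exact ⟨h0, h1.neg, h2.neg, h3.neg⟩
  | mul a b ha hb =>
    obtain ⟨h0, h1, h2, h3⟩ := ha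
    obtain ⟨k0, k1, k2, k3⟩ := hb
    simp only [map_mul, Submonoid.coe_mul, Quaternion.re_mul, Quaternion.imI_mul,
      Quaternion.imJ_mul, Quaternion.imK_mul]
    refine ⟨?_, ?_, ?_, ?_⟩ <;> fun_prop

lemma word_conj (Z : UH) (A : Fin 3 → UH) (w : FreeGroup (Fin 3)) :
    FreeGroup.lift (fun i => Z * A i * Z⁻¹) w = Z * FreeGroup.lift A w * Z⁻¹ := by
  have : FreeGroup.lift (fun i => Z * A i * Z⁻¹) =
      (MulAut.conj Z).toMonoidHom.comp (FreeGroup.lift A) := 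
    FreeGroup.ext_hom _ _ (fun i => by simp)
  rw [this]; simp

lemma conj_comp (Q : UH) (t : ℝ) (R : UH) (hR : R = U (t/2) 0 0 * Q * (U (t/2) 0 0)⁻¹) :
    (R : Quaternion ℝ).re = (Q : Quaternion ℝ).re ∧
    (R : Quaternion ℝ).imI =
      Real.cos t * (Q : Quaternion ℝ).imI - Real.sin t * (Q : Quaternion ℝ).imJ ∧
    (R : Quaternion ℝ).imJ =
      Real.sin t * (Q : Quaternion ℝ).imI + Real.cos t * (Q : Quaternion ℝ).imJ ∧
    (R : Quaternion ℝ).imK = (Q : Quaternion ℝ).imK := by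
  have h1 := Real.sin_sq_add_cos_sq (t/2)
  have hs : Real.sin t = 2 * Real.sin (t/2) * Real.cos (t/2) := by
    rw [← Real.sin_two_mul]; congr 1; ring
  have hc : Real.cos t = Real.cos (t/2) ^ 2 - Real.sin (t/2) ^ 2 := by
    rw [← Real.cos_two_mul']; congr 1; ring
  rw [hR, ← Unitary.star_eq_inv]
  refine ⟨?_, ?_, ?_, ?_⟩
  · simp
    linear_combination (Q : Quaternion ℝ).re * h1
  · simp [hs, hc]
    ring
  · simp [hs, hc]
    ring
  · simp
    linear_combination (Q : Quaternion ℝ).imK * h1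

/-- Heart of the argument. -/
lemma topo (w : FreeGroup (Fin 3)) (e : Fin 3 → ℤ)
    (he : ∀ t : Fin 3 → ℝ, FreeGroup.lift (fun i => Multiplicative.ofAdd (t i)) w =
      Multiplicative.ofAdd (∑ i, e i * t i))
    (τ : Fin 3 → ℝ) (κ : ℝ)
    (s1 : κ * Real.sin (e 0 * τ 0 + e 1 * τ 1 + e 2 * τ 2) < 0)
    (s2 : 0 < κ * Real.sin (-(e 0 * τ 0) + e 1 * τ 1 + e 2 * τ 2))
    (s3 : 0 < κ * Real.sin (e 0 * τ 0 + e 1 * τ 1 - e 2 * τ 2))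
    (s4 : κ * Real.sin (-(e 0 * τ 0) + e 1 * τ 1 - e 2 * τ 2) < 0) :
    ∃ θ φ : Fin 3 → ℝ, ∀ Q : Quaternion ℝ,
      Q = (FreeGroup.lift (fun i => U (τ i) (θ i) (φ i)) w : Quaternion ℝ) →
      Q.imI = 0 ∧ Q.imJ = 0 ∧ Q.imK = 0 := by
  by_contra! hcon
  let A : Fin 3 → E3 → UH := fun i x => ![U (τ 0) (x 1) (x 2), U (τ 1) 0 0, U (τ 2) (x 0) 0] i
  have hA : ∀ i, ContDiff ℝ 3 (fun x => (A i x : Quaternion ℝ).re) ∧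
      ContDiff ℝ 3 (fun x => (A i x : Quaternion ℝ).imI) ∧
      ContDiff ℝ 3 (fun x => (A i x : Quaternion ℝ).imJ) ∧
      ContDiff ℝ 3 (fun x => (A i x : Quaternion ℝ).imK) := by
    have e0 : ContDiff ℝ 3 (fun x : E3 => x 0) := contDiff_apply _ _ _
    have e1 : ContDiff ℝ 3 (fun x : E3 => x 1) := contDiff_apply _ _ _
    have e2 : ContDiff ℝ 3 (fun x : E3 => x 2) := contDiff_apply _ _ _
    intro i
    have gen : ∀ (t : ℝ) (u v : E3 → ℝ), ContDiff ℝ 3 u → ContDiff ℝ 3 v →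
        ContDiff ℝ 3 (fun x => (U t (u x) (v x) : Quaternion ℝ).re) ∧
        ContDiff ℝ 3 (fun x => (U t (u x) (v x) : Quaternion ℝ).imI) ∧
        ContDiff ℝ 3 (fun x => (U t (u x) (v x) : Quaternion ℝ).imJ) ∧
        ContDiff ℝ 3 (fun x => (U t (u x) (v x) : Quaternion ℝ).imK) := by
      intro t u v hu hv
      simp only [U_coe, Uq_re, Uq_imI, Uq_imJ, Uq_imK]
      refine ⟨contDiff_const, ?_, ?_, ?_⟩ <;> fun_prop
    fin_cases i
    · exact gen (τ 0) (fun x => x 1) (fun x => x 2) e1 e2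
    · exact gen (τ 1) (fun x => 0) (fun x => 0) contDiff_const contDiff_const
    · exact gen (τ 2) (fun x => x 0) (fun x => 0) e0 contDiff_const
  let W : E3 → UH := fun x => FreeGroup.lift (fun i => A i x) w
  obtain ⟨hW0, hW1, hW2, hW3⟩ := word_smooth A hA w
  let P : Fin 3 → E3 → ℝ := ![fun x => (W x : Quaternion ℝ).imI, fun x => (W x : Quaternion ℝ).imJ,
    fun x => (W x : Quaternion ℝ).imK]
  have hP : ∀ a, ContDiff ℝ 3 (P a) := by
    intro a; fin_cases a
    · exact hW1
    · exact hW2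
    · exact hW3
  let n2 : E3 → ℝ := fun x => P 0 x ^ 2 + P 1 x ^ 2 + P 2 x ^ 2
  have hn2 : ∀ x, 0 < n2 x := by
    intro x
    obtain ⟨Q, hQ, hQ2⟩ := hcon ![x 1, 0, x 0] ![x 2, 0, 0]
    have hQW : Q = W x := by
      rw [hQ]
      congr 3
      funext i
      fin_cases i <;> rfl
    subst hQW
    have : ¬ (P 0 x = 0 ∧ P 1 x = 0 ∧ P 2 x = 0) := by
      rintro ⟨a, b, c⟩
      exact hQ2 a b c
    have hnn : 0 ≤ n2 x := by positivity
    rcases hnn.lt_or_eq with h | h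
    · exact h
    · exfalso
      apply this
      simp only [n2] at h
      refine ⟨?_, ?_, ?_⟩ <;> apply pow_eq_zero_iff (two_ne_zero) |>.mp <;>
        nlinarith [sq_nonneg (P 0 x), sq_nonneg (P 1 x), sq_nonneg (P 2 x)]
  have hn2c : ContDiff ℝ 3 n2 := (((hP 0).pow 2).add ((hP 1).pow 2)).add ((hP 2).pow 2)
  let f : Fin 3 → E3 → ℝ := fun a x => P a x / Real.sqrt (n2 x)
  have hf : ∀ a, ContDiff ℝ 3 (f a) := fun a =>
    (hP a).div (hn2c.sqrt (fun x => (hn2 x).ne')) (fun x => (Real.sqrt_pos.mpr (hn2 x)).ne')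
  have hWf : ∀ x y, W x = W y → ∀ a, f a x = f a y := by
    intro x y h a
    have hp : ∀ a, P a x = P a y := by
      intro a; fin_cases a <;> simp [P, h]
    simp only [f, n2, hp]
  have hconj : ∀ x t, (x 0 = 0 ∨ x 0 = Real.pi) →
      W (x + Pi.single 2 t) = U (t/2) 0 0 * W x * (U (t/2) 0 0)⁻¹ := by
    intro x t hx
    simp only [W]
    rw [← word_conj]
    congr 2
    funext i
    have hsin : Real.sin (x 0) = 0 := by rcases hx with h | h <;> simp [h]
    obtain ⟨c0, c1, c2, c3⟩ := conj_comp (A i x) t _ rfl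
    apply Subtype.ext
    apply Quaternion.ext
    · rw [c0]; clear c0 c1 c2 c3
      fin_cases i <;> simp [A]
    · rw [c1]; clear c0 c1 c2 c3
      fin_cases i
      · simp [A, Real.cos_add]; ring
      · simp [A]
      · simp [A, hsin]
    · rw [c2]; clear c0 c1 c2 c3
      fin_cases i
      · simp [A, Real.sin_add]; ring
      · simp [A]
      · simp [A, hsin]
    · rw [c3]; clear c0 c1 c2 c3
      fin_cases i <;> simp [A]
  have hPr : ∀ x t, (x 0 = 0 ∨ x 0 = Real.pi) →
      P 0 (x + Pi.single 2 t) = Real.cos t * P 0 x - Real.sin t * P 1 x ∧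
      P 1 (x + Pi.single 2 t) = Real.sin t * P 0 x + Real.cos t * P 1 x ∧
      P 2 (x + Pi.single 2 t) = P 2 x ∧ n2 (x + Pi.single 2 t) = n2 x := by
    intro x t hx
    obtain ⟨-, a0, a1, a2⟩ := conj_comp (W x) t _ (hconj x t hx)
    replace a0 : P 0 (x + Pi.single 2 t) = Real.cos t * P 0 x - Real.sin t * P 1 x := a0
    replace a1 : P 1 (x + Pi.single 2 t) = Real.sin t * P 0 x + Real.cos t * P 1 x := a1
    replace a2 : P 2 (x + Pi.single 2 t) = P 2 x := a2
    refine ⟨a0, a1, a2, ?_⟩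
    simp only [n2, a0, a1, a2]
    linear_combination (P 0 x ^ 2 + P 1 x ^ 2) * Real.sin_sq_add_cos_sq t
  have key := degree f hf
    (by
      intro x
      have h1 := Real.sq_sqrt (hn2 x).le
      have h2 := (Real.sqrt_pos.mpr (hn2 x)).ne'
      simp only [f]
      field_simp
      rw [h1])
    (by
      intro a x
      apply hWf
      simp only [W]
      congr 2
      funext i
      apply Subtype.ext
      fin_cases i <;> apply Quaternion.ext <;> simp [A])
    (by
      intro a x t hx
      apply hWf
      simp only [W]
      congr 2
      funext i
      have hsin : Real.sin (x 1) = 0 := by rcases hx with h | h <;> simp [h]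
      apply Subtype.ext
      fin_cases i <;> apply Quaternion.ext <;> simp [A, hsin])
    (by
      intro x t hx
      obtain ⟨a0, a1, a2, a3⟩ := hPr x t hx
      simp only [f, a0, a3]; ring)
    (by
      intro x t hx
      obtain ⟨a0, a1, a2, a3⟩ := hPr x t hx
      simp only [f, a1, a3]; ring)
    (by
      intro x t hx
      obtain ⟨a0, a1, a2, a3⟩ := hPr x t hx
      simp only [f, a2, a3])
  have hval : ∀ x : E3, ∀ t : Fin 3 → ℝ, (∀ i, A i x = E (Multiplicative.ofAdd (t i))) →
      f 2 x = Real.sin (∑ i, e i * t i) / |Real.sin (∑ i, e i * t i)| := by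
    intro x t h
    have hW : W x = E (Multiplicative.ofAdd (∑ i, e i * t i)) := by
      rw [← he t]
      simp only [W]
      have : FreeGroup.lift (fun i => A i x) =
          E.comp (FreeGroup.lift (fun i => Multiplicative.ofAdd (t i))) :=
        FreeGroup.ext_hom _ _ (fun i => by simp [h])
      rw [this]; rfl
    rw [E_apply] at hW
    have p0 : P 0 x = 0 := by simp [P, hW]
    have p1 : P 1 x = 0 := by simp [P, hW]
    have p2 : P 2 x = Real.sin (∑ i, e i * t i) := by simp [P, hW]
    simp only [f, n2, p0, p1, p2]
    congr 1
    rw [← Real.sqrt_sq_eq_abs]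
    congr 1
    ring
  have v1 := hval ![0, 0, 0] ![τ 0, τ 1, τ 2] (by intro i; fin_cases i <;> rfl)
  have v2 := hval ![0, Real.pi, 0] ![-τ 0, τ 1, τ 2] (by
    intro i; fin_cases i
    · exact U_pi _
    · rfl
    · rfl)
  have v3 := hval ![Real.pi, 0, 0] ![τ 0, τ 1, -τ 2] (by
    intro i; fin_cases i
    · rfl
    · rfl
    · exact U_pi _)
  have v4 := hval ![Real.pi, Real.pi, 0] ![-τ 0, τ 1, -τ 2] (by
    intro i; fin_cases i
    · exact U_pi _
    · rfl
    · exact U_pi _)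
  rw [v1, v2, v3, v4] at key
  simp only [Fin.sum_univ_three] at key
  simp only [Matrix.cons_val_zero, Matrix.cons_val_one, Matrix.cons_val, mul_neg, ← sub_eq_add_neg] at key
  have pos : ∀ z : ℝ, 0 < z → z / |z| = 1 := fun z hz => by rw [abs_of_pos hz, div_self hz.ne']
  have neg : ∀ z : ℝ, z < 0 → z / |z| = -1 := fun z hz => by
    rw [abs_of_neg hz, div_neg, div_self hz.ne]
  rcases lt_trichotomy κ 0 with hk | hk | hk
  · rw [neg _ (by nlinarith), pos _ (by nlinarith), pos _ (by nlinarith), neg _ (by nlinarith)] at key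
    norm_num at key
  · simp [hk] at s1
  · rw [pos _ (pos_of_mul_pos_right s2 hk.le), neg _ (by nlinarith), neg _ (by nlinarith), pos _ (pos_of_mul_pos_right s3 hk.le)] at key
    norm_num at key



lemma expsum (w : FreeGroup (Fin 3)) : ∃ e : Fin 3 → ℤ, ∀ (M : Type) [AddCommGroup M]
    (t : Fin 3 → M), FreeGroup.lift (fun i => Multiplicative.ofAdd (t i)) w =
      Multiplicative.ofAdd (∑ i, e i • t i) := by
  induction w using FreeGroup.induction_on with
  | C1 => exact ⟨0, fun M _ t => by simp⟩
  | of i =>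
    refine ⟨Pi.single i 1, fun M _ t => ?_⟩
    rw [FreeGroup.lift_apply_of]
    congr 1
    rw [Finset.sum_eq_single i]
    · simp
    · intro j _ hj; simp [hj]
    · simp
  | inv_of i _ =>
    refine ⟨Pi.single i (-1), fun M _ t => ?_⟩
    rw [map_inv, FreeGroup.lift_apply_of, ← ofAdd_neg]
    congr 1
    rw [Finset.sum_eq_single i]
    · simp
    · intro j _ hj; simp [hj]
    · simp
  | mul a b ha hb =>
    obtain ⟨e, he⟩ := ha
    obtain ⟨f, hf⟩ := hb
    refine ⟨e + f, fun M _ t => ?_⟩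
    rw [map_mul, he, hf, ← ofAdd_add, ← Finset.sum_add_distrib]
    congr 1
    exact Finset.sum_congr rfl (fun i _ => by simp [add_smul])

section homs
variable {G : Fin 3 → Type*} [∀ i, Group (G i)]

/-- The presentation map from the free group. -/
def pres (a : ∀ i, G i) : FreeGroup (Fin 3) →* Monoid.CoprodI G :=
  FreeGroup.lift (fun i => Monoid.CoprodI.of (a i))

lemma pres_surj (a : ∀ i, G i) (ha : ∀ i x, x ∈ Subgroup.zpowers (a i)) :
    Function.Surjective (pres a) := by
  rw [← MonoidHom.range_eq_top, eq_top_iff]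
  rintro x -
  induction x using Monoid.CoprodI.induction_on with
  | one => exact one_mem _
  | of i m =>
    obtain ⟨n, rfl⟩ := Subgroup.mem_zpowers_iff.mp (ha i m)
    exact ⟨FreeGroup.of i ^ n, by simp [pres]⟩
  | mul x y hx hy => exact mul_mem hx hy

lemma exists_hom (a : ∀ i, G i) (ha : ∀ i x, x ∈ Subgroup.zpowers (a i))
    (p : Fin 3 → ℕ) (hp : ∀ i, p i ∣ orderOf (a i)) {H : Type*} [Group H] (b : Fin 3 → H)
    (hb : ∀ i, b i ^ p i = 1) :
    ∃ Φ : Monoid.CoprodI G →* H, ∀ w, Φ (pres a w) = FreeGroup.lift b w := by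
  have hd : ∀ i, orderOf (b i) ∣ orderOf (a i) := fun i =>
    (orderOf_dvd_of_pow_eq_one (hb i)).trans (hp i)
  let Φ : Monoid.CoprodI G →* H :=
    Monoid.CoprodI.lift (fun i => monoidHomOfForallMemZpowers (ha i) (hd i))
  refine ⟨Φ, fun w => ?_⟩
  have : Φ.comp (pres a) = FreeGroup.lift b := FreeGroup.ext_hom _ _ (fun i => by
    simp [Φ, pres])
  exact DFunLike.congr_fun this w

lemma abelian_case (a : ∀ i, G i) (ha : ∀ i x, x ∈ Subgroup.zpowers (a i))
    (p : Fin 3 → ℕ) (hp : ∀ i, p i ∣ orderOf (a i)) (w : FreeGroup (Fin 3)) (e : Fin 3 → ℤ)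
    (he : ∀ (M : Type) [AddCommGroup M]
      (t : Fin 3 → M), FreeGroup.lift (fun i => Multiplicative.ofAdd (t i)) w =
      Multiplicative.ofAdd (∑ i, e i • t i)) (q : ℕ) [NeZero q] (t : Fin 3 → ZMod q)
    (h0 : ∀ i, p i • t i = 0) (j : Fin 3) (hj : t j ≠ 0) (hsum : ∑ i, e i • t i = 0) :
    ∃ N : Subgroup (Monoid.CoprodI G),
      N.Normal ∧ N.FiniteIndex ∧ N ≠ ⊤ ∧ pres a w ∈ N := by
  obtain ⟨Φ, hΦ⟩ := exists_hom a ha p hp (fun i => Multiplicative.ofAdd (t i)) (fun i => by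
    rw [← ofAdd_nsmul, h0, ofAdd_zero])
  refine ⟨Φ.ker, inferInstance, ?_, ?_, ?_⟩
  · have : Finite (Multiplicative (ZMod q)) := inferInstanceAs (Finite (ZMod q))
    exact Subgroup.finiteIndex_ker Φ
  · intro h
    have : pres a (FreeGroup.of j) ∈ Φ.ker := by rw [h]; trivial
    rw [MonoidHom.mem_ker, hΦ, FreeGroup.lift_apply_of] at this
    exact hj this
  · rw [MonoidHom.mem_ker, hΦ, he, hsum]; rfl

end homs

/-- Conjugation action of unit quaternions. -/
noncomputable def cj : UH →* Module.End ℝ (Quaternion ℝ) where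
  toFun A := LinearMap.mulLeft ℝ (A : Quaternion ℝ) * LinearMap.mulRight ℝ (star (A : Quaternion ℝ))
  map_one' := by
    ext1 x
    simp
  map_mul' A B := by
    apply LinearMap.ext
    intro x
    simp [mul_assoc]

lemma cj_apply (A : UH) (x : Quaternion ℝ) : cj A x = A * x * star (A : Quaternion ℝ) := by
  simp [cj, mul_assoc]

lemma cj_eq_one (A : UH) (h1 : (A : Quaternion ℝ).imI = 0) (h2 : (A : Quaternion ℝ).imJ = 0)
    (h3 : (A : Quaternion ℝ).imK = 0) : cj A = 1 := by
  apply LinearMap.ext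
  intro x
  have hc : (A : Quaternion ℝ) * x = x * A := by
    apply Quaternion.ext <;> simp [h1, h2, h3] <;> ring
  rw [cj_apply, hc, mul_assoc, Unitary.mul_star_self_of_mem A.2]
  simp

lemma cj_U_ne_one (t θ φ : ℝ) (ht : Real.sin t ≠ 0) : cj (U t θ φ) ≠ 1 := by
  intro h
  have hc : ∀ x : Quaternion ℝ, Uq t θ φ * x = x * Uq t θ φ := by
    intro x
    have h1 : cj (U t θ φ) x = x := by rw [h]; rfl
    rw [cj_apply, U_coe] at h1
    calc Uq t θ φ * x = Uq t θ φ * x * (star (Uq t θ φ) * Uq t θ φ) := by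
          rw [Uq_star_mul, mul_one]
      _ = (Uq t θ φ * x * star (Uq t θ φ)) * Uq t θ φ := by simp only [mul_assoc]
      _ = x * Uq t θ φ := by rw [h1]
  let qi : Quaternion ℝ := ⟨0, 1, 0, 0⟩
  let qj : Quaternion ℝ := ⟨0, 0, 1, 0⟩
  have i0 : qi.re = 0 := rfl
  have i1 : qi.imI = 1 := rfl
  have i2 : qi.imJ = 0 := rfl
  have i3 : qi.imK = 0 := rfl
  have j0 : qj.re = 0 := rfl
  have j1 : qj.imI = 0 := rfl
  have j2 : qj.imJ = 1 := rfl
  have j3 : qj.imK = 0 := rfl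
  have a1 := congrArg (fun q : Quaternion ℝ => q.imJ) (hc qi)
  have a2 := congrArg (fun q : Quaternion ℝ => q.imK) (hc qi)
  have a3 := congrArg (fun q : Quaternion ℝ => q.imK) (hc qj)
  simp only [Quaternion.imJ_mul, Quaternion.imK_mul, i0, i1, i2, i3, j0, j1, j2, j3,
    Uq_re, Uq_imI, Uq_imJ, Uq_imK] at a1 a2 a3
  apply ht
  have k1 : Real.sin t * Real.cos θ = 0 := by linarith
  have k2 : Real.sin t * Real.sin θ * Real.sin φ = 0 := by linarith
  have k3 : Real.sin t * Real.sin θ * Real.cos φ = 0 := by linarith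
  have h2 := Real.sin_sq_add_cos_sq θ
  have h3 := Real.sin_sq_add_cos_sq φ
  apply pow_eq_zero_iff (two_ne_zero) |>.mp
  linear_combination (Real.sin t * Real.cos θ) * k1 +
    (Real.sin t * Real.sin θ * Real.sin φ) * k2 + (Real.sin t * Real.sin θ * Real.cos φ) * k3
    - Real.sin t ^ 2 * h2 - Real.sin t ^ 2 * Real.sin θ ^ 2 * h3

lemma half_bounds (p : ℕ) (hp : p.Prime) :
    (1/3 : ℝ) ≤ ((p / 2 : ℕ) : ℝ) / p ∧ ((p / 2 : ℕ) : ℝ) / p ≤ 1/2 ∧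
      (p ≠ 3 → (1/3 : ℝ) < ((p / 2 : ℕ) : ℝ) / p) := by
  have h2 := hp.two_le
  have hpos : (0 : ℝ) < p := by exact_mod_cast hp.pos
  have hodd := hp.eq_two_or_odd
  refine ⟨?_, ?_, ?_⟩
  · rw [div_le_div_iff₀ (by norm_num) hpos]
    have : 1 * p ≤ (p / 2) * 3 := by omega
    exact_mod_cast this
  · rw [div_le_div_iff₀ hpos (by norm_num)]
    have : (p / 2) * 2 ≤ 1 * p := by omega
    exact_mod_cast this
  · intro h3
    rw [div_lt_div_iff₀ (by norm_num) hpos]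
    have : 1 * p < (p / 2) * 3 := by
      rcases hodd with h | h
      · subst h; norm_num
      · omega
    exact_mod_cast this

lemma solve_k (p : ℕ) (hp : p.Prime) (e : ℤ) (he : ¬ (p : ℤ) ∣ e) :
    ∃ k m : ℤ, e * k = (p / 2 : ℕ) + m * p ∧ ¬ (p : ℤ) ∣ k := by
  have hc : IsCoprime e (p : ℤ) :=
    ((Nat.prime_iff_prime_int.mp hp).coprime_iff_not_dvd.mpr he).symm
  obtain ⟨u, v, huv⟩ := hc
  have h1 : e * (u * (p / 2 : ℕ)) = (p / 2 : ℕ) + (-(v * (p / 2 : ℕ))) * p := by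
    linear_combination ((p / 2 : ℕ) : ℤ) * huv
  refine ⟨_, _, h1, fun hd => ?_⟩
  have h2 : (p : ℤ) ∣ (p / 2 : ℕ) := by
    have := (Dvd.dvd.mul_left hd e)
    rw [h1] at this
    exact (dvd_add_left (Dvd.intro_left _ rfl)).mp this
  have h3 := Nat.le_of_dvd (by have := hp.two_le; omega) (Int.natCast_dvd_natCast.mp h2)
  have := hp.two_le
  omega

lemma sign_fix (M n : ℤ) (h : Even (M + n)) (x : ℝ) :
    (-1 : ℝ) ^ M * Real.sin (x + n * Real.pi) = Real.sin x := by
  rw [Real.sin_add_int_mul_pi, ← mul_assoc, ← zpow_add₀ (by norm_num), h.neg_one_zpow, one_mul]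

lemma main_case {G : Fin 3 → Type*} [∀ i, Group (G i)]
    (a : ∀ i, G i) (ha : ∀ i x, x ∈ Subgroup.zpowers (a i))
    (p : Fin 3 → ℕ) (hpp : ∀ i, (p i).Prime) (hp : ∀ i, p i ∣ orderOf (a i))
    (w : FreeGroup (Fin 3)) (e : Fin 3 → ℤ)
    (he : ∀ t : Fin 3 → ℝ, FreeGroup.lift (fun i => Multiplicative.ofAdd (t i)) w =
      Multiplicative.ofAdd (∑ i, e i * t i))
    (hnd : ∀ i, ¬ (p i : ℤ) ∣ e i) (hne : p 0 ≠ p 1) :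
    ∃ N : Subgroup (Monoid.CoprodI G),
      N.Normal ∧ N.FiniteIndex ∧ N ≠ ⊤ ∧ pres a w ∈ N := by
  choose k m hkm hk using fun i => solve_k (p i) (hpp i) (e i) (hnd i)
  let α : Fin 3 → ℝ := fun i => Real.pi * (((p i / 2 : ℕ) : ℝ) / p i)
  let τ : Fin 3 → ℝ := fun i => Real.pi * k i / p i
  have hp0 : ∀ i, (p i : ℝ) ≠ 0 := fun i => by exact_mod_cast (hpp i).ne_zero
  have hτ : ∀ i, e i * τ i = α i + m i * Real.pi := by
    intro i
    have h1 : (e i : ℝ) * k i = ((p i / 2 : ℕ) : ℝ) + m i * p i := by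
      have h := congrArg (fun z : ℤ => (z : ℝ)) (hkm i)
      simp only [Int.cast_mul, Int.cast_add, Int.cast_natCast] at h
      exact h
    have h2 := hp0 i
    simp only [τ, α]
    field_simp
    linear_combination h1
  have hs : ∀ i, Real.sin (τ i) ≠ 0 := by
    intro i h
    obtain ⟨n, hn⟩ := Real.sin_eq_zero_iff.mp h
    apply hk i
    have h2 := hp0 i
    have h3 := Real.pi_ne_zero
    simp only [τ] at hn
    field_simp at hn
    refine ⟨n, ?_⟩
    have : (k i : ℝ) = p i * n := by linear_combination -hn
    exact_mod_cast this
  have hpi := Real.pi_pos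
  have b1 : ∀ i, Real.pi / 3 ≤ α i := fun i => by
    have := mul_le_mul_of_nonneg_left (half_bounds _ (hpp i)).1 hpi.le
    simp only [α]; linarith
  have b2 : ∀ i, α i ≤ Real.pi / 2 := fun i => by
    have := mul_le_mul_of_nonneg_left (half_bounds _ (hpp i)).2.1 hpi.le
    simp only [α]; linarith
  have b3 : ∀ i, p i ≠ 3 → Real.pi / 3 < α i := fun i h => by
    have := mul_lt_mul_of_pos_left ((half_bounds _ (hpp i)).2.2 h) hpi
    simp only [α]; linarith
  have b4 : Real.pi < α 0 + α 1 + α 2 := by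
    have h0 := b1 0
    have h1 := b1 1
    have h2 := b1 2
    by_cases h : p 0 = 3
    · have := b3 1 (fun h' => hne (h.trans h'.symm))
      linarith
    · have := b3 0 h
      linarith
  have c0 := b1 0
  have c1 := b1 1
  have c2 := b1 2
  have d0 := b2 0
  have d1 := b2 1
  have d2 := b2 2
  obtain ⟨θ, φ, hθ⟩ := topo w e he τ ((-1 : ℝ) ^ (m 0 + m 1 + m 2))
    (by
      rw [hτ, hτ, hτ, show α 0 + m 0 * Real.pi + (α 1 + m 1 * Real.pi) + (α 2 + m 2 * Real.pi) =
        (α 0 + α 1 + α 2) + ((m 0 + m 1 + m 2 : ℤ) : ℝ) * Real.pi by push_cast; ring,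
        sign_fix _ _ ⟨m 0 + m 1 + m 2, rfl⟩]
      rw [← neg_pos, ← Real.sin_sub_pi]
      exact Real.sin_pos_of_pos_of_lt_pi (by linarith) (by linarith))
    (by
      rw [hτ, hτ, hτ, show -(α 0 + m 0 * Real.pi) + (α 1 + m 1 * Real.pi) + (α 2 + m 2 * Real.pi) =
        (-α 0 + α 1 + α 2) + ((-m 0 + m 1 + m 2 : ℤ) : ℝ) * Real.pi by push_cast; ring,
        sign_fix _ _ ⟨m 1 + m 2, by ring⟩]
      exact Real.sin_pos_of_pos_of_lt_pi (by linarith) (by linarith))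
    (by
      rw [hτ, hτ, hτ, show (α 0 + m 0 * Real.pi) + (α 1 + m 1 * Real.pi) - (α 2 + m 2 * Real.pi) =
        (α 0 + α 1 - α 2) + ((m 0 + m 1 - m 2 : ℤ) : ℝ) * Real.pi by push_cast; ring,
        sign_fix _ _ ⟨m 0 + m 1, by ring⟩]
      exact Real.sin_pos_of_pos_of_lt_pi (by linarith) (by linarith))
    (by
      rw [hτ, hτ, hτ, show -(α 0 + m 0 * Real.pi) + (α 1 + m 1 * Real.pi) - (α 2 + m 2 * Real.pi) =
        (-α 0 + α 1 - α 2) + ((-m 0 + m 1 - m 2 : ℤ) : ℝ) * Real.pi by push_cast; ring,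
        sign_fix _ _ ⟨m 1, by ring⟩]
      exact Real.sin_neg_of_neg_of_neg_pi_lt (by linarith) (by linarith))
  obtain ⟨z1, z2, z3⟩ := hθ _ rfl
  let A : Fin 3 → UH := fun i => U (τ i) (θ i) (φ i)
  have hword : cj (FreeGroup.lift A w) = 1 := cj_eq_one _ z1 z2 z3
  have hpow : ∀ i, cj.toHomUnits (A i) ^ p i = 1 := by
    intro i
    rw [← map_pow]
    apply Units.ext
    rw [MonoidHom.coe_toHomUnits, Units.val_one]
    have h2 := hp0 i
    have hpt : (p i : ℝ) * τ i = k i * Real.pi := by simp only [τ]; field_simp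
    have hsin : Real.sin (k i * Real.pi) = 0 := Real.sin_int_mul_pi _
    simp only [A]
    rw [U_pow, hpt]
    apply cj_eq_one <;> simp [hsin]
  obtain ⟨Φ, hΦ⟩ := exists_hom a ha p hp (fun i => cj.toHomUnits (A i)) hpow
  have hlift : ∀ v, FreeGroup.lift (fun i => cj.toHomUnits (A i)) v =
      cj.toHomUnits (FreeGroup.lift A v) := by
    intro v
    have : FreeGroup.lift (fun i => cj.toHomUnits (A i)) =
        cj.toHomUnits.comp (FreeGroup.lift A) := FreeGroup.ext_hom _ _ (fun i => by simp)
    rw [this]; rfl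
  let bs : Module.Basis (Fin 4) ℝ (Quaternion ℝ) := QuaternionAlgebra.basisOneIJK (-1 : ℝ) 0 (-1)
  let mt : Module.End ℝ (Quaternion ℝ) ≃ₐ[ℝ] Matrix (Fin 4) (Fin 4) ℝ := LinearMap.toMatrixAlgEquiv bs
  let ρ : Monoid.CoprodI G →* Matrix (Fin 4) (Fin 4) ℝ :=
    (mt.toMulEquiv.toMonoidHom.comp (Units.coeHom _)).comp Φ
  have hρ : ∀ v, ρ (pres a v) = 1 ↔ cj (FreeGroup.lift A v) = 1 := by
    intro v
    have : ρ (pres a v) = mt (cj (FreeGroup.lift A v)) := by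
      change mt ((Φ (pres a v) : (Module.End ℝ (Quaternion ℝ))ˣ) : Module.End ℝ (Quaternion ℝ)) = _
      rw [hΦ, hlift, MonoidHom.coe_toHomUnits]
    rw [this]
    exact map_eq_one_iff mt mt.injective
  classical
  obtain ⟨N, h1, h2, h3, h4⟩ := malcev
    (Finset.univ.image (fun i => pres a (FreeGroup.of i))) (by
      rw [Finset.coe_image, Finset.coe_univ, Set.image_univ]
      have h := FreeGroup.closure_range_of (Fin 3)
      have h' := congrArg (Subgroup.map (pres a)) h
      rw [MonoidHom.map_closure, ← MonoidHom.range_eq_map,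
        MonoidHom.range_eq_top.mpr (pres_surj a ha), ← Set.range_comp] at h'
      exact h') ρ (pres a (FreeGroup.of 0)) (by
      rw [Ne, hρ, FreeGroup.lift_apply_of]
      exact cj_U_ne_one _ _ _ (hs 0))
  exact ⟨N, h1, h2, h3, h4 _ ((hρ w).mpr hword)⟩

end SW

/-- **Corollary 4.3 (Chinyere–Howie).** Any free product of three nontrivial cyclic groups is
finitely annihilated: every nontrivial element lies in some proper normal subgroup of finite
index (i.e. it becomes trivial in some nontrivial finite quotient). -/
theorem free_product_of_three_cyclics_finitely_annihilated
    {G : Fin 3 → Type*} [∀ i, Group (G i)] [∀ i, Nontrivial (G i)] [∀ i, IsCyclic (G i)]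
    (g : Monoid.CoprodI G) (hg : g ≠ 1) :
    ∃ N : Subgroup (Monoid.CoprodI G),
      N.Normal ∧ N.FiniteIndex ∧ N ≠ ⊤ ∧ g ∈ N := by
  choose a ha using fun i => IsCyclic.exists_generator (α := G i)
  have hord : ∀ i, orderOf (a i) ≠ 1 := by
    intro i h
    rw [orderOf_eq_one_iff] at h
    obtain ⟨x, hx⟩ := exists_ne (1 : G i)
    have := ha i x
    rw [h, Subgroup.zpowers_one_eq_bot, Subgroup.mem_bot] at this
    exact hx this
  choose p hpp hp using fun i => Nat.exists_prime_and_dvd (hord i)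
  obtain ⟨w, rfl⟩ := SW.pres_surj a ha g
  obtain ⟨e, he⟩ := SW.expsum w
  by_cases h1 : ∃ i, (p i : ℤ) ∣ e i
  · obtain ⟨i, hi⟩ := h1
    have : Fact (p i).Prime := ⟨hpp i⟩
    refine SW.abelian_case a ha p hp w e he (p i) (Pi.single i 1) ?_ i (by simp) ?_
    · intro j
      by_cases h : j = i
      · subst h; simp
      · simp [h]
    · rw [Finset.sum_eq_single i]
      · simpa using (ZMod.intCast_zmod_eq_zero_iff_dvd (e i) (p i)).mpr hi
      · intro j _ hj; simp [hj]
      · simp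
  push Not at h1
  by_cases h2 : p 0 = p 1
  · have : Fact (p 0).Prime := ⟨hpp 0⟩
    refine SW.abelian_case a ha p hp w e he (p 0) ![(e 1 : ZMod (p 0)), -(e 0 : ZMod (p 0)), 0]
      ?_ 1 ?_ ?_
    · intro j
      fin_cases j
      · simp
      · simp [← h2]
      · simp
    · have := mt (ZMod.intCast_zmod_eq_zero_iff_dvd (e 0) (p 0)).mp (h1 0)
      simpa using this
    · simp [Fin.sum_univ_three]
      ring
  · refine SW.main_case a ha p hpp hp w e (fun t => ?_) h1 h2
    rw [he]
    simp
end

section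
/- With the standing assumptions, suppose in addition that U = αβ or U = (αβ)⁻¹ and V = α₁β₁, where α, α₁ are nontrivial elements of A and β, β₁ are nontrivial elements of B. Then G is nontrivial. -/
open Monoid

/-- The free-product length of an element of an indexed free product: the number of letters
in its unique reduced expression as an alternating product of nontrivial elements of the
factors (the identity has length `0`). -/
noncomputable def CoprodI.length {ι : Type*} {G : ι → Type*} [∀ i, Group (G i)]
    (w : Monoid.CoprodI G) : ℕ :=
  letI := Classical.decEq ι
  letI : ∀ i, DecidableEq (G i) := fun i => Classical.decEq (G i)
  (Monoid.CoprodI.Word.equiv w).toList.length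

/-- The first two factors `A = G 0`, `B = G 1` of a triple of groups, as a family over
`Fin 2`; their free product `Monoid.CoprodI (subFamily G)` is the free product `A*B`. -/
def subFamily (G : Fin 3 → Type*) : Fin 2 → Type _ := fun i => G i.castSucc

instance (G : Fin 3 → Type*) [∀ i, Group (G i)] (i : Fin 2) : Group (subFamily G i) :=
  inferInstanceAs (Group (G i.castSucc))

/-- The canonical embedding of the free product `A*B` into the free product `A*B*C`. -/
def CoprodI.embed (G : Fin 3 → Type*) [∀ i, Group (G i)] :
    Monoid.CoprodI (subFamily G) →* Monoid.CoprodI G :=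
  Monoid.CoprodI.lift fun i => (Monoid.CoprodI.of : G i.castSucc →* Monoid.CoprodI G)

universe u v

namespace P56

/-- Two-element family of groups. -/
def fam (P Q : Type u) : Bool → Type u
  | true => P
  | false => Q

instance famGroup (P Q : Type u) [Group P] [Group Q] : ∀ i, Group (fam P Q i)
  | true => inferInstanceAs (Group P)
  | false => inferInstanceAs (Group Q)

/-- Free products, seen through the first-letter functions on reduced words. -/
lemma exists_headed (A B : Type u) [Group A] [Group B] :
    ∃ (H : Type u) (_ : Group H) (i : A →* H) (j : B →* H) (S : Type u) (_ : MulAction H S)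
      (hA : S → A) (hB : S → B), Nonempty S ∧ (∀ g s, hA (i g • s) = g * hA s) ∧
      (∀ g s, hB (j g • s) = g * hB s) ∧ (∀ s, hA s ≠ 1 → hB s = 1) := by
  classical
  refine ⟨Monoid.CoprodI (fam A B), inferInstance,
    (Monoid.CoprodI.of : fam A B true →* _), (Monoid.CoprodI.of : fam A B false →* _),
    Monoid.CoprodI.Word (fam A B), inferInstance,
    fun w => (Monoid.CoprodI.Word.equivPair true w).head,
    fun w => (Monoid.CoprodI.Word.equivPair false w).head, ⟨Monoid.CoprodI.Word.empty⟩,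
    ?_, ?_, ?_⟩
  · intro g s
    exact congrArg Monoid.CoprodI.Word.Pair.head
      (Monoid.CoprodI.Word.equivPair_smul_same (M := fam A B) (i := true) g s)
  · intro g s
    exact congrArg Monoid.CoprodI.Word.Pair.head
      (Monoid.CoprodI.Word.equivPair_smul_same (M := fam A B) (i := false) g s)
  · intro s hs
    by_cases h : s.fstIdx = some true
    · have h2 : s.fstIdx ≠ some false := by rw [h]; simp
      exact congrArg Monoid.CoprodI.Word.Pair.head
        (Monoid.CoprodI.Word.equivPair_eq_of_fstIdx_ne h2)
    · exact absurd (congrArg Monoid.CoprodI.Word.Pair.head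
        (Monoid.CoprodI.Word.equivPair_eq_of_fstIdx_ne h)) hs

/-- `x, y` freely generate a free group of rank two. -/
def FreePair {H : Type u} [Group H] (x y : H) : Prop :=
  Function.Injective (FreeGroup.lift (fun b : ULift.{u} Bool => cond b.down x y))

open scoped Pointwise in
lemma freePair_of_pingpong {H S : Type u} [Group H] [MulAction H S] (x y : H)
    (X₁ Y₁ X₂ Y₂ : Set S) (n₁ : X₁.Nonempty) (n₂ : X₂.Nonempty)
    (d₁ : Disjoint X₁ X₂) (d₂ : Disjoint Y₁ Y₂) (d₃ : Disjoint X₁ Y₁) (d₄ : Disjoint X₁ Y₂)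
    (d₅ : Disjoint X₂ Y₁) (d₆ : Disjoint X₂ Y₂)
    (h₁ : ∀ s, s ∉ Y₁ → x • s ∈ X₁) (h₂ : ∀ s, s ∉ X₁ → x⁻¹ • s ∈ Y₁)
    (h₃ : ∀ s, s ∉ Y₂ → y • s ∈ X₂) (h₄ : ∀ s, s ∉ X₂ → y⁻¹ • s ∈ Y₂) : FreePair x y := by
  unfold FreePair
  refine FreeGroup.injective_lift_of_ping_pong (ι := ULift.{u} Bool) _
    (fun b => cond b.down X₁ X₂) (fun b => cond b.down Y₁ Y₂) ?_ ?_ ?_ ?_ ?_ ?_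
  · rintro ⟨_ | _⟩ <;> assumption
  · rintro ⟨_ | _⟩ ⟨_ | _⟩ h
    · exact absurd rfl h
    · exact d₁.symm
    · exact d₁
    · exact absurd rfl h
  · rintro ⟨_ | _⟩ ⟨_ | _⟩ h
    · exact absurd rfl h
    · exact d₂.symm
    · exact d₂
    · exact absurd rfl h
  · rintro ⟨_ | _⟩ ⟨_ | _⟩ <;> assumption
  · rintro ⟨_ | _⟩ _ ⟨s, hs, rfl⟩
    · exact h₃ s hs
    · exact h₁ s hs
  · rintro ⟨_ | _⟩ _ ⟨s, hs, rfl⟩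
    · exact h₄ s hs
    · exact h₂ s hs

lemma FreePair.inv_right {H : Type u} [Group H] {x y : H} (h : FreePair x y) :
    FreePair x y⁻¹ := by
  let φ : FreeGroup (ULift.{u} Bool) →* FreeGroup (ULift.{u} Bool) :=
    FreeGroup.lift (fun b => cond b.down (FreeGroup.of b) (FreeGroup.of b)⁻¹)
  have hφ : φ.comp φ = MonoidHom.id _ := by
    ext ⟨_ | _⟩ <;> simp [φ]
  have hinj : Function.Injective φ := by
    intro a b hab
    have := congrArg φ hab
    rwa [← MonoidHom.comp_apply, ← MonoidHom.comp_apply, hφ] at this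
  have : FreeGroup.lift (fun b : ULift.{u} Bool => cond b.down x y⁻¹) =
      (FreeGroup.lift (fun b : ULift.{u} Bool => cond b.down x y)).comp φ := by
    ext ⟨_ | _⟩ <;> simp [φ]
  unfold FreePair
  rw [this]
  rw [MonoidHom.coe_comp]
  exact Function.Injective.comp h hinj

/-- In `A * B`, the elements `ba` and `a'b'` are free generators if nothing cancels. -/
lemma exists_freePair (A B : Type u) [Group A] [Group B] (a a' : A) (b b' : B)
    (ha : a ≠ 1) (ha' : a' ≠ 1) (hb : b ≠ 1) (hb' : b' ≠ 1) (haa : a * a' ≠ 1)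
    (hbb : b' * b ≠ 1) :
    ∃ (H : Type u) (_ : Group H) (i : A →* H) (j : B →* H),
      Function.Injective i ∧ Function.Injective j ∧ FreePair (j b * i a) (i a' * j b') := by
  obtain ⟨H, _, i, j, S, _, hA, hB, ⟨s₀⟩, eA, eB, hAB⟩ := exists_headed A B
  have hBA : ∀ s, hB s ≠ 1 → hA s = 1 := fun s hs => by
    by_contra h; exact hs (hAB s h)
  refine ⟨H, inferInstance, i, j, ?_, ?_, ?_⟩
  · intro g g' h
    have h1 := eA g s₀
    rw [h, eA g' s₀] at h1
    exact (mul_right_cancel h1).symm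
  · intro g g' h
    have h1 := eB g s₀
    rw [h, eB g' s₀] at h1
    exact (mul_right_cancel h1).symm
  have iA : ∀ g s, hA ((i g)⁻¹ • s) = g⁻¹ * hA s := fun g s => by rw [← map_inv, eA]
  have iB : ∀ g s, hB ((j g)⁻¹ • s) = g⁻¹ * hB s := fun g s => by rw [← map_inv, eB]
  have key : ∀ {g : A}, g ≠ 1 → (∀ s, hA s = g → hB s = 1) := fun hg s h =>
    hAB s (by rwa [h])
  refine freePair_of_pingpong _ _ {s | hB s = b} {s | hA s = a⁻¹} {s | hA s = a'}
    {s | hB s = b'⁻¹} ⟨j (b * (hB s₀)⁻¹) • s₀, by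
      simp only [Set.mem_ofPred_eq]; rw [eB, inv_mul_cancel_right]⟩
    ⟨i (a' * (hA s₀)⁻¹) • s₀, by
      simp only [Set.mem_ofPred_eq]; rw [eA, inv_mul_cancel_right]⟩ ?_ ?_ ?_ ?_ ?_ ?_ ?_ ?_ ?_ ?_
  · refine Set.disjoint_left.2 fun s h1 h2 => hb ?_
    simp only [Set.mem_ofPred_eq] at h1 h2
    rw [← h1]; exact key ha' s h2
  · refine Set.disjoint_left.2 fun s h1 h2 => inv_ne_one.2 hb' ?_
    simp only [Set.mem_ofPred_eq] at h1 h2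
    rw [← h2]; exact key (inv_ne_one.2 ha) s h1
  · refine Set.disjoint_left.2 fun s h1 h2 => hb ?_
    simp only [Set.mem_ofPred_eq] at h1 h2
    rw [← h1]; exact key (inv_ne_one.2 ha) s h2
  · refine Set.disjoint_left.2 fun s h1 h2 => hbb ?_
    simp only [Set.mem_ofPred_eq] at h1 h2
    rw [← h1, h2]; simp
  · refine Set.disjoint_left.2 fun s h1 h2 => haa ?_
    simp only [Set.mem_ofPred_eq] at h1 h2
    rw [← h1, h2]; simp
  · refine Set.disjoint_left.2 fun s h1 h2 => inv_ne_one.2 hb' ?_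
    simp only [Set.mem_ofPred_eq] at h1 h2
    rw [← h2]; exact key ha' s h1
  · intro s hs
    simp only [Set.mem_ofPred_eq] at hs ⊢
    rw [mul_smul, eB, hAB, mul_one]
    rw [eA]
    exact fun h => hs (eq_inv_of_mul_eq_one_right h)
  · intro s hs
    simp only [Set.mem_ofPred_eq] at hs ⊢
    rw [mul_inv_rev, mul_smul, iA, hBA, mul_one]
    rw [iB]
    exact fun h => hs (inv_mul_eq_one.1 h).symm
  · intro s hs
    simp only [Set.mem_ofPred_eq] at hs ⊢
    rw [mul_smul, eA, hBA, mul_one]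
    rw [eB]
    exact fun h => hs (eq_inv_of_mul_eq_one_right h)
  · intro s hs
    simp only [Set.mem_ofPred_eq] at hs ⊢
    rw [mul_inv_rev, mul_smul, iB, hAB, mul_one]
    rw [iA]
    exact fun h => hs (inv_mul_eq_one.1 h).symm

/-- In `C * ⟨t⟩`, the elements `t` and `c t c'` are free generators if `c c' ≠ 1`. -/
lemma exists_freePair_C (C : Type u) [Group C] (c c' : C) (hc : c ≠ 1) (hc' : c' ≠ 1)
    (hcc : c * c' ≠ 1) :
    ∃ (K : Type u) (_ : Group K) (f : C →* K) (t : K),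
      Function.Injective f ∧ FreePair t (f c * t * f c') := by
  obtain ⟨H, _, f, j, S, _, hA, hB, ⟨s₀⟩, eA, eB, hAB⟩ :=
    exists_headed C (ULift.{u} (Multiplicative ℤ))
  have hBA : ∀ s, hB s ≠ 1 → hA s = 1 := fun s hs => by
    by_contra h; exact hs (hAB s h)
  let e : S → ℤ := fun s => Multiplicative.toAdd (hB s).down
  let t : H := j ⟨Multiplicative.ofAdd 1⟩
  have et : ∀ s, e (t • s) = 1 + e s := fun s => by
    simp only [e, t, eB]; rfl
  have et' : ∀ s, e (t⁻¹ • s) = -1 + e s := fun s => by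
    have := et (t⁻¹ • s)
    rw [smul_inv_smul] at this
    omega
  have he : ∀ s, e s = 0 ↔ hB s = 1 := fun s => by
    constructor
    · intro h
      exact ULift.ext _ _ (Multiplicative.toAdd.injective h)
    · intro h
      simp [e, h]
  have iA : ∀ g s, hA ((f g)⁻¹ • s) = g⁻¹ * hA s := fun g s => by rw [← map_inv, eA]
  have k1 : ∀ s, hA s ≠ 1 → e s = 0 := fun s h => (he s).2 (hAB s h)
  have k2 : ∀ s, e s ≠ 0 → hA s = 1 := fun s h => hBA s (fun h' => h ((he s).2 h'))
  refine ⟨H, inferInstance, f, t, ?_, ?_⟩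
  · intro g g' h
    have h1 := eA g s₀
    rw [h, eA g' s₀] at h1
    exact (mul_right_cancel h1).symm
  have main1 : ∀ s, hA s ≠ c'⁻¹ → hA ((f c * t * f c') • s) = c := by
    intro s hs
    rw [mul_smul, mul_smul, eA, k2, mul_one]
    rw [et, k1]
    · simp
    · rw [eA]
      exact fun h => hs (eq_inv_of_mul_eq_one_right h)
  refine freePair_of_pingpong _ _ {s | 0 < e s} {s | e s < 0} {s | hA s = c}
    {s | hA s = c'⁻¹} ?_
    ⟨f (c * (hA s₀)⁻¹) • s₀, by
      simp only [Set.mem_ofPred_eq]; rw [eA, inv_mul_cancel_right]⟩ ?_ ?_ ?_ ?_ ?_ ?_ ?_ ?_ ?_ ?_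
  · refine ⟨t • f (c * (hA s₀)⁻¹) • s₀, ?_⟩
    simp only [Set.mem_ofPred_eq]
    rw [et, k1]
    · simp
    · rwa [eA, inv_mul_cancel_right]
  · refine Set.disjoint_left.2 fun s h1 h2 => ?_
    simp only [Set.mem_ofPred_eq] at h1 h2
    have := k1 s (by rwa [h2])
    omega
  · refine Set.disjoint_left.2 fun s h1 h2 => ?_
    simp only [Set.mem_ofPred_eq] at h1 h2
    have := k1 s (by rw [h2]; exact inv_ne_one.2 hc')
    omega
  · refine Set.disjoint_left.2 fun s h1 h2 => ?_
    simp only [Set.mem_ofPred_eq] at h1 h2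
    omega
  · refine Set.disjoint_left.2 fun s h1 h2 => ?_
    simp only [Set.mem_ofPred_eq] at h1 h2
    have := k1 s (by rw [h2]; exact inv_ne_one.2 hc')
    omega
  · refine Set.disjoint_left.2 fun s h1 h2 => ?_
    simp only [Set.mem_ofPred_eq] at h1 h2
    have := k1 s (by rwa [h1])
    omega
  · refine Set.disjoint_left.2 fun s h1 h2 => ?_
    simp only [Set.mem_ofPred_eq] at h1 h2
    apply hcc
    rw [← h1, h2]; simp
  · intro s hs
    simp only [Set.mem_ofPred_eq] at hs ⊢
    rw [et]; omega
  · intro s hs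
    simp only [Set.mem_ofPred_eq] at hs ⊢
    rw [et']; omega
  · exact main1
  · intro s hs
    simp only [Set.mem_ofPred_eq] at hs ⊢
    rw [mul_inv_rev, mul_inv_rev, mul_smul, mul_smul, iA, k2, mul_one]
    rw [et', k1]
    · simp
    · rw [iA]
      exact fun h => hs (inv_mul_eq_one.1 h).symm

/-- Amalgamated free products of two groups. -/
lemma exists_amalgam {L : Type v} {P Q : Type u} [Group L] [Group P] [Group Q]
    (φ : L →* P) (ψ : L →* Q) (hφ : Function.Injective φ) (hψ : Function.Injective ψ) :
    ∃ (R : Type (max u v)) (_ : Group R) (f : P →* R) (g : Q →* R),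
      Function.Injective f ∧ Function.Injective g ∧ ∀ l, f (φ l) = g (ψ l) := by
  let θ : ∀ i, L →* fam P Q i := fun i => match i with
    | true => φ
    | false => ψ
  have hθ : ∀ i, Function.Injective (θ i) := fun i => match i with
    | true => hφ
    | false => hψ
  refine ⟨Monoid.PushoutI θ, inferInstance, Monoid.PushoutI.of (φ := θ) true,
    Monoid.PushoutI.of (φ := θ) false, Monoid.PushoutI.of_injective hθ true,
    Monoid.PushoutI.of_injective hθ false, fun l => ?_⟩
  exact (Monoid.PushoutI.of_apply_eq_base θ true l).trans
    (Monoid.PushoutI.of_apply_eq_base θ false l).symm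

lemma amalg_free {C H : Type u} [Group C] [Group H] (c c' : C) (hc : c ≠ 1) (hc' : c' ≠ 1)
    (hcc : c * c' ≠ 1) (U V : H) (hUV : FreePair U V) :
    ∃ (R : Type u) (_ : Group R) (f : C →* R) (g : H →* R),
      Function.Injective f ∧ Function.Injective g ∧ f c * g U * f c' * g V = 1 := by
  obtain ⟨K, _, f, t, hf, ht⟩ := exists_freePair_C C c c' hc hc' hcc
  obtain ⟨R, _, p, q, hp, hq, h⟩ := exists_amalgam _ _ ht.inv_right hUV
  refine ⟨R, inferInstance, p.comp f, q, hp.comp hf, hq, ?_⟩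
  have h1 := h (FreeGroup.of ⟨true⟩)
  have h2 := h (FreeGroup.of ⟨false⟩)
  simp only [FreeGroup.lift_apply_of, cond_true, cond_false] at h1 h2
  rw [← h1, ← h2]
  simp [mul_assoc]

/-- Joining two groups along elements of equal order. -/
lemma exists_join {P Q : Type u} [Group P] [Group Q] (p : P) (q : Q)
    (h : orderOf p = orderOf q) :
    ∃ (R : Type u) (_ : Group R) (f : P →* R) (g : Q →* R),
      Function.Injective f ∧ Function.Injective g ∧ f p = g q := by
  have aux : ∀ {P : Type u} [Group P] (p : P) (n : ℕ), orderOf p = n →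
      ∃ φ : Multiplicative (ZMod n) →* P,
      Function.Injective φ ∧ φ (Multiplicative.ofAdd 1) = p := by
    rintro P _ p n rfl
    let f : {f : ℤ →+ Additive P // f (orderOf p) = 0} :=
      ⟨zmultiplesHom (Additive P) (Additive.ofMul p), by
        apply Additive.toMul.injective
        simp [pow_orderOf_eq_one]⟩
    refine ⟨AddMonoidHom.toMultiplicativeLeft (ZMod.lift (orderOf p) f), ?_, ?_⟩
    · have : Function.Injective (ZMod.lift (orderOf p) f) := by
        rw [ZMod.lift_injective]
        intro m hm
        rw [ZMod.intCast_zmod_eq_zero_iff_dvd]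
        rw [orderOf_dvd_iff_zpow_eq_one]
        exact hm
      exact this
    · have : ZMod.lift (orderOf p) f ((1 : ℤ) : ZMod (orderOf p)) = Additive.ofMul p := by
        rw [ZMod.lift_coe]
        simp [f]
      simp only [Int.cast_one] at this
      exact this
  obtain ⟨φ, hφ, h1⟩ := aux p _ h
  obtain ⟨ψ, hψ, h2⟩ := aux q _ rfl
  obtain ⟨R, _, f, g, hf, hg, hfg⟩ := exists_amalgam φ ψ hφ hψ
  exact ⟨R, inferInstance, f, g, hf, hg, (congrArg f h1).symm.trans ((hfg _).trans (congrArg g h2))⟩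

lemma exists_orderOf (n : ℕ) (hn : n ≠ 1) : ∃ z : ℂ, z ≠ 0 ∧ z ≠ 1 ∧ orderOf z = n := by
  have key : ∃ z : ℂ, z ≠ 0 ∧ orderOf z = n := by
    rcases Nat.eq_zero_or_pos n with rfl | h
    · refine ⟨2, two_ne_zero, ?_⟩
      rw [orderOf_eq_zero_iff']
      intro k hk h
      have h2 : ((2 ^ k : ℕ) : ℂ) = ((1 : ℕ) : ℂ) := by push_cast; exact h
      have h3 : 2 ^ k = 1 := Nat.cast_injective h2
      have := Nat.one_lt_two_pow hk.ne'
      omega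
    · exact ⟨_, (Complex.exp_ne_zero _),
        ((Complex.isPrimitiveRoot_exp n h.ne').eq_orderOf).symm⟩
  obtain ⟨z, h0, h⟩ := key
  refine ⟨z, h0, ?_, h⟩
  rintro rfl
  exact hn (by rw [← h, orderOf_one])

lemma orderOf_pgl (M : GL (Fin 2) ℂ) (l w : ℂ) (hl : l ≠ 0) (hw : w ≠ 1)
    (htr : M.val 0 0 + M.val 1 1 = l * (1 + w))
    (hdet : M.val 0 0 * M.val 1 1 - M.val 0 1 * M.val 1 0 = l ^ 2 * w) :
    orderOf (QuotientGroup.mk M : GL (Fin 2) ℂ ⧸ Subgroup.center (GL (Fin 2) ℂ)) =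
      orderOf w := by
  rw [orderOf_eq_orderOf_iff]
  intro k
  have CH : M.val * M.val = (l * (1 + w)) • M.val - (l ^ 2 * w) • 1 := by
    rw [← htr, ← hdet]
    ext i j
    fin_cases i <;> fin_cases j <;> simp [Matrix.mul_apply, Fin.sum_univ_two] <;> ring
  have pw : ∀ k : ℕ, ((w - 1) * l) • M.val ^ k =
      (l ^ k * (w ^ k - 1)) • M.val + (l ^ (k + 1) * (w - w ^ k)) • (1 : Matrix _ _ ℂ) := by
    intro k
    induction k with
    | zero => simp [mul_comm]
    | succ k ih =>
      rw [pow_succ, ← smul_mul_assoc, ih, add_mul, smul_mul_assoc, smul_mul_assoc, CH, one_mul]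
      ext i j
      simp only [Matrix.add_apply, Matrix.smul_apply, Matrix.sub_apply, smul_eq_mul]
      ring
  rw [← QuotientGroup.mk_pow, QuotientGroup.eq_one_iff,
    Matrix.GeneralLinearGroup.mem_center_iff_val_mem_range_scalar]
  have hne : (w - 1) * l ≠ 0 := mul_ne_zero (sub_ne_zero.2 hw) hl
  constructor
  · rintro ⟨r, hr⟩
    have hr' : M.val ^ k = Matrix.scalar (Fin 2) r := by rw [hr]; simp
    have e := pw k
    rw [hr'] at e
    by_contra hk
    have hk' : l ^ k * (w ^ k - 1) ≠ 0 := mul_ne_zero (pow_ne_zero _ hl) (sub_ne_zero.2 hk)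
    have e00 := congrFun (congrFun e 0) 0
    have e01 := congrFun (congrFun e 0) 1
    have e11 := congrFun (congrFun e 1) 1
    simp at e00 e01 e11
    have h01 : M.val 0 1 = 0 := by
      rcases e01 with (h | h) | h
      · exact absurd h.1 hl
      · exact absurd (sub_eq_zero.1 h) hk
      · exact h
    have hd : M.val 0 0 = M.val 1 1 := by
      apply mul_left_cancel₀ hk'
      linear_combination e11 - e00
    rw [h01, hd] at hdet
    rw [hd] at htr
    have : (l * (w - 1)) ^ 2 = 0 := by
      linear_combination (-(2 * M.val 1 1) - l * (1 + w)) * htr + 4 * hdet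
    exact mul_ne_zero hl (sub_ne_zero.2 hw) (pow_eq_zero_iff two_ne_zero |>.1 this)
  · intro hk
    refine ⟨l ^ k, ?_⟩
    have e := pw k
    rw [hk] at e
    have : M.val ^ k = (l ^ k) • (1 : Matrix _ _ ℂ) := by
      have e2 : ((w - 1) * l) • M.val ^ k = ((w - 1) * l) • ((l ^ k) • (1 : Matrix _ _ ℂ)) := by
        rw [e, smul_smul, sub_self, mul_zero, zero_smul, zero_add]
        congr 1
        ring
      exact smul_right_injective _ hne e2
    rw [Units.val_pow_eq_pow_val, this]
    ext i j
    fin_cases i <;> fin_cases j <;> simp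

lemma exists_triangle (p q m : ℕ) (hp : p ≠ 1) (hq : q ≠ 1) (hm : m ≠ 1) :
    ∃ (D : Type) (_ : Group D) (x y : D),
      orderOf x = p ∧ orderOf y = q ∧ orderOf (x * y) = m := by
  obtain ⟨z, hz0, hz1, rfl⟩ := exists_orderOf p hp
  obtain ⟨e, he0, he1, rfl⟩ := exists_orderOf q hq
  obtain ⟨w, hw0, hw1, rfl⟩ := exists_orderOf m hm
  obtain ⟨l, hl⟩ := IsAlgClosed.exists_pow_nat_eq (z * e / w) (n := 2) (by norm_num)
  have hlw : l ^ 2 * w = z * e := by rw [hl]; field_simp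
  have hl0 : l ≠ 0 := by
    rintro rfl
    have : z * e = 0 := by rw [← hlw]; simp
    exact mul_ne_zero hz0 he0 this
  let t : ℂ := l * (1 + w) - 1 - z * e
  let X : GL (Fin 2) ℂ := Matrix.GeneralLinearGroup.mkOfDetNeZero !![1, 1; 0, z]
    (by simpa [Matrix.det_fin_two] using hz0)
  let Y : GL (Fin 2) ℂ := Matrix.GeneralLinearGroup.mkOfDetNeZero !![1, 0; t, e]
    (by simpa [Matrix.det_fin_two] using he0)
  have hX : X.val = !![1, 1; 0, z] := rfl
  have hY : Y.val = !![1, 0; t, e] := rfl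
  refine ⟨GL (Fin 2) ℂ ⧸ Subgroup.center (GL (Fin 2) ℂ), inferInstance, QuotientGroup.mk X,
    QuotientGroup.mk Y, ?_, ?_, ?_⟩
  · apply orderOf_pgl X 1 z one_ne_zero hz1 <;> simp [hX]
  · apply orderOf_pgl Y 1 e one_ne_zero he1 <;> simp [hY]
  · rw [← QuotientGroup.mk_mul]
    have hXY : (X * Y).val = !![1 + t, e; z * t, z * e] := by
      rw [Units.val_mul, hX, hY]
      ext i j
      fin_cases i <;> fin_cases j <;> simp [Matrix.mul_apply, Fin.sum_univ_two]
    apply orderOf_pgl (X * Y) l w hl0 hw1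
    · rw [hXY]; simp [t]; ring
    · rw [hXY, hlw]; simp; ring

lemma exists_square (C : Type u) [Group C] (c c' : C) :
    ∃ (K : Type u) (_ : Group K) (f : C →* K) (x : K),
      Function.Injective f ∧ x ≠ 1 ∧ f c * x * f c' * x = 1 := by
  let f : C →* Equiv.Perm (C × Bool) :=
    { toFun := fun g => (Equiv.mulLeft g).prodCongr (Equiv.refl _)
      map_one' := by ext x <;> simp
      map_mul' := fun g h => by ext x <;> simp [mul_assoc] }
  let x : Equiv.Perm (C × Bool) :=
    { toFun := fun s => (cond s.2 (c'⁻¹ * s.1) (c⁻¹ * s.1), !s.2)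
      invFun := fun s => (cond s.2 (c * s.1) (c' * s.1), !s.2)
      left_inv := by rintro ⟨g, _ | _⟩ <;> simp
      right_inv := by rintro ⟨g, _ | _⟩ <;> simp }
  refine ⟨_, inferInstance, f, x, ?_, ?_, ?_⟩
  · intro g h hgh
    have := congrArg (fun e : Equiv.Perm (C × Bool) => (e (1, true)).1) hgh
    simpa [f] using this
  · intro h
    have := congrArg (fun e : Equiv.Perm (C × Bool) => (e (1, true)).2) h
    simp [x] at this
  · ext ⟨g, _ | _⟩ <;> simp [f, x]

/-- Solvability of `c a b c' a' b' = 1` in an overgroup of `A`, `B` and `C`. -/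
def Solv {A B C : Type u} [Group A] [Group B] [Group C] (c : C) (a : A) (b : B) (c' : C)
    (a' : A) (b' : B) : Prop :=
  ∃ (R : Type u) (_ : Group R) (i : A →* R) (j : B →* R) (f : C →* R),
    Function.Injective i ∧ Function.Injective j ∧ Function.Injective f ∧
      f c * i a * j b * f c' * i a' * j b' = 1

variable {A B C : Type u} [Group A] [Group B] [Group C]

lemma Solv.rotate {c c' : C} {a a' : A} {b b' : B} (h : Solv c a b c' a' b') :
    Solv a b c' a' b' c := by
  obtain ⟨R, _, i, j, f, hi, hj, hf, h⟩ := h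
  refine ⟨R, inferInstance, j, f, i, hj, hf, hi, ?_⟩
  have h2 : i a * j b * f c' * i a' * j b' = (f c)⁻¹ := by
    apply eq_inv_of_mul_eq_one_right
    simpa [mul_assoc] using h
  rw [h2, inv_mul_cancel]

lemma solv_free (c c' : C) (a a' : A) (b b' : B) (hc : c ≠ 1) (hc' : c' ≠ 1)
    (hcc : c * c' ≠ 1) (ha : a ≠ 1) (ha' : a' ≠ 1) (hb : b ≠ 1) (hb' : b' ≠ 1)
    (haa : a ≠ a') (hbb : b ≠ b') : Solv c a b c' a' b' := by
  obtain ⟨H, _, j, i, hj, hi, hF⟩ := exists_freePair B A b b'⁻¹ a a'⁻¹ hb (inv_ne_one.2 hb') ha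
    (inv_ne_one.2 ha') (fun h => hbb (mul_inv_eq_one.1 h))
    (fun h => haa (inv_mul_eq_one.1 h).symm)
  obtain ⟨R, _, f, g, hf, hg, h⟩ := amalg_free c c' hc hc' hcc _ _ hF.inv_right
  refine ⟨R, inferInstance, g.comp i, g.comp j, f, hg.comp hi, hg.comp hj, hf, ?_⟩
  simpa [mul_assoc] using h

lemma solv_square (c c' : C) (a : A) (b : B) (ha : a ≠ 1) (hb : b ≠ 1) :
    Solv c a b c' a b := by
  obtain ⟨K, _, f, x, hf, hx, h⟩ := exists_square C c c'
  obtain ⟨D, _, y, z, hy, hz, hyz⟩ := exists_triangle (orderOf a) (orderOf b) (orderOf x)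
    (by simpa using ha) (by simpa using hb) (by simpa using hx)
  let up : D →* ULift.{u} D := (MulEquiv.ulift (α := D)).symm.toMonoidHom
  have hup : Function.Injective up := (MulEquiv.ulift (α := D)).symm.injective
  obtain ⟨R₁, _, i₁, d₁, hi₁, hd₁, e₁⟩ := exists_join a (up y)
    (by rw [orderOf_injective up hup, hy])
  obtain ⟨R₂, _, r₂, j₂, hr₂, hj₂, e₂⟩ := exists_join (d₁ (up z)) b
    (by rw [orderOf_injective d₁ hd₁, orderOf_injective up hup, hz])
  have e₃ : r₂ (i₁ a) * j₂ b = r₂ (d₁ (up (y * z))) := by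
    rw [← e₂, e₁, map_mul, map_mul, map_mul]
  obtain ⟨R, _, r, g, hr, hg, e⟩ := exists_join (r₂ (i₁ a) * j₂ b) x
    (by rw [e₃, orderOf_injective r₂ hr₂, orderOf_injective d₁ hd₁, orderOf_injective up hup, hyz])
  refine ⟨R, inferInstance, r.comp (r₂.comp i₁), r.comp j₂, g.comp f,
    hr.comp (hr₂.comp hi₁), hr.comp hj₂, hg.comp hf, ?_⟩
  have h4 := congrArg g h
  rw [map_mul, map_mul, map_mul, ← e, map_one] at h4
  simpa [mul_assoc] using h4

lemma solv_case1 (c c' : C) (a a' : A) (b b' : B) (hc : c ≠ 1) (hc' : c' ≠ 1)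
    (hcc : c * c' ≠ 1) (ha : a ≠ 1) (ha' : a' ≠ 1) (hb : b ≠ 1) (hb' : b' ≠ 1)
    (haa : a * a' ≠ 1) (hbb : b * b' ≠ 1) : Solv c a b c' a' b' := by
  by_cases h1 : a = a'
  · by_cases h2 : b = b'
    · subst h1 h2
      exact solv_square c c' a b ha hb
    · by_cases h3 : c = c'
      · subst h1 h3
        exact (solv_square b' b c a hc ha).rotate
      · -- the distinguished factor is `A`
        exact (solv_free a a' b b' c' c ha ha' haa hb hb' hc' hc h2 (Ne.symm h3)
          : Solv a b c' a' b' c).rotate.rotate.rotate.rotate.rotate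
  · by_cases h2 : b = b'
    · by_cases h3 : c = c'
      · subst h2 h3
        exact (solv_square a' a b c hb hc).rotate.rotate
      · exact (solv_free b' b c c' a a' hb' hb
          (fun h => hbb (mul_eq_one_iff_eq_inv.2 (eq_inv_of_mul_eq_one_right h)))
          hc hc' ha ha' h3 h1 : Solv b' c a b c' a').rotate
    · exact solv_free c c' a a' b b' hc hc' hcc ha ha' hb hb' h1 h2

lemma solv_case2 (c c' : C) (a a' : A) (b b' : B) (hc : c ≠ 1) (hc' : c' ≠ 1)
    (hcc : c * c' ≠ 1) (ha : a ≠ 1) (ha' : a' ≠ 1) (hb : b ≠ 1) (hb' : b' ≠ 1)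
    (haa : a * a' ≠ 1) (hbb : b' * b ≠ 1) :
    ∃ (R : Type u) (_ : Group R) (i : A →* R) (j : B →* R) (f : C →* R),
      Function.Injective f ∧ f c * (j b * i a) * f c' * (i a' * j b') = 1 := by
  obtain ⟨H, _, i, j, hi, hj, hF⟩ := exists_freePair A B a a' b b' ha ha' hb hb' haa hbb
  obtain ⟨R, _, f, g, hf, hg, h⟩ := amalg_free c c' hc hc' hcc _ _ hF
  exact ⟨R, inferInstance, g.comp i, g.comp j, f, hf, by simpa using h⟩

lemma nontrivial_of_hom {G : Fin 3 → Type u} [∀ i, Group (G i)] [∀ i, Nontrivial (G i)]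
    {R : Type u} [Group R] (i : subFamily G 0 →* R) (j : subFamily G 1 →* R) (f : G 2 →* R)
    (hf : Function.Injective f) (c₁ c₂ : G 2) (U V : Monoid.CoprodI (subFamily G))
    (h : ∀ F : Monoid.CoprodI (subFamily G) →* R,
      (∀ x : subFamily G 0, F ((Monoid.CoprodI.of : subFamily G 0 →* _) x) = i x) →
      (∀ x : subFamily G 1, F ((Monoid.CoprodI.of : subFamily G 1 →* _) x) = j x) →
      f c₁ * F U * f c₂ * F V = 1) :
    Nontrivial (Monoid.CoprodI G ⧸ Subgroup.normalClosure
      {(Monoid.CoprodI.of : G 2 →* Monoid.CoprodI G) c₁ * CoprodI.embed G U *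
        (Monoid.CoprodI.of : G 2 →* Monoid.CoprodI G) c₂ * CoprodI.embed G V}) := by
  let F : Monoid.CoprodI G →* R := Monoid.CoprodI.lift (fun k => match k with
    | 0 => i
    | 1 => j
    | 2 => f)
  have F2 : ∀ x : G 2, F (Monoid.CoprodI.of x) = f x := fun x => Monoid.CoprodI.lift_of _ x
  have hw := h (F.comp (CoprodI.embed G))
    (fun x => by
      rw [MonoidHom.comp_apply]
      exact (congrArg F (Monoid.CoprodI.lift_of _ _)).trans (Monoid.CoprodI.lift_of _ _))
    (fun x => by
      rw [MonoidHom.comp_apply]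
      exact (congrArg F (Monoid.CoprodI.lift_of _ _)).trans (Monoid.CoprodI.lift_of _ _))
  obtain ⟨x, hx⟩ := exists_ne (1 : G 2)
  refine ⟨⟨QuotientGroup.mk (Monoid.CoprodI.of x), 1, fun h1 => hx ?_⟩⟩
  rw [QuotientGroup.eq_one_iff] at h1
  have hle : Subgroup.normalClosure
      {(Monoid.CoprodI.of : G 2 →* Monoid.CoprodI G) c₁ * CoprodI.embed G U *
        (Monoid.CoprodI.of : G 2 →* Monoid.CoprodI G) c₂ * CoprodI.embed G V} ≤ F.ker := by
    apply Subgroup.normalClosure_le_normal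
    rintro _ rfl
    change F _ = 1
    rw [map_mul, map_mul, map_mul, F2, F2]
    exact hw
  have h2 : F (Monoid.CoprodI.of x) = 1 := hle h1
  rw [F2] at h2
  exact hf (h2.trans (map_one f).symm)

end P56

/-- **Proposition 5.6 (Chinyere–Howie).** Standing assumptions as in Lemma 5.3.  If
`U = αβ` or `U = (αβ)⁻¹` and `V = α₁β₁`, with `α, α₁` nontrivial in `A` and
`β, β₁` nontrivial in `B`, then `G` is nontrivial. -/
theorem prop_5_6
    {G : Fin 3 → Type*} [∀ i, Group (G i)] [∀ i, Nontrivial (G i)]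
    (c₁ c₂ : G 2) (hc₁ : c₁ ≠ 1) (hc₂ : c₂ ≠ 1) (hc₁c₂ : c₁ * c₂ ≠ 1)
    (U V : Monoid.CoprodI (subFamily G))
    (hlen : CoprodI.length U + CoprodI.length V ≤ 6)
    (hUVA : U * V ∉ Subgroup.normalClosure
      (Set.range (Monoid.CoprodI.of : subFamily G 0 →* Monoid.CoprodI (subFamily G))))
    (hUVB : U * V ∉ Subgroup.normalClosure
      (Set.range (Monoid.CoprodI.of : subFamily G 1 →* Monoid.CoprodI (subFamily G))))
    (α α₁ : subFamily G 0) (β β₁ : subFamily G 1)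
    (hα : α ≠ 1) (hα₁ : α₁ ≠ 1) (hβ : β ≠ 1) (hβ₁ : β₁ ≠ 1)
    (hU : U = (Monoid.CoprodI.of : subFamily G 0 →* Monoid.CoprodI (subFamily G)) α * (Monoid.CoprodI.of : subFamily G 1 →* Monoid.CoprodI (subFamily G)) β ∨
      U = ((Monoid.CoprodI.of : subFamily G 0 →* Monoid.CoprodI (subFamily G)) α * (Monoid.CoprodI.of : subFamily G 1 →* Monoid.CoprodI (subFamily G)) β)⁻¹)
    (hV : V = (Monoid.CoprodI.of : subFamily G 0 →* Monoid.CoprodI (subFamily G)) α₁ * (Monoid.CoprodI.of : subFamily G 1 →* Monoid.CoprodI (subFamily G)) β₁)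
    :
    Nontrivial (Monoid.CoprodI G ⧸ Subgroup.normalClosure
      {(Monoid.CoprodI.of : G 2 →* Monoid.CoprodI G) c₁ * CoprodI.embed G U *
        (Monoid.CoprodI.of : G 2 →* Monoid.CoprodI G) c₂ * CoprodI.embed G V}) := by
  have memA : ∀ x : subFamily G 0, (Monoid.CoprodI.of : subFamily G 0 →* Monoid.CoprodI (subFamily G)) x ∈
      Subgroup.normalClosure (Set.range
        (Monoid.CoprodI.of : subFamily G 0 →* Monoid.CoprodI (subFamily G))) :=
    fun x => Subgroup.subset_normalClosure ⟨x, rfl⟩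
  have memB : ∀ x : subFamily G 1, (Monoid.CoprodI.of : subFamily G 1 →* Monoid.CoprodI (subFamily G)) x ∈
      Subgroup.normalClosure (Set.range
        (Monoid.CoprodI.of : subFamily G 1 →* Monoid.CoprodI (subFamily G))) :=
    fun x => Subgroup.subset_normalClosure ⟨x, rfl⟩
  rcases hU with rfl | rfl
  · subst hV
    have haa : α * α₁ ≠ 1 := by
      intro h
      rw [mul_eq_one_iff_inv_eq] at h
      subst h
      apply hUVB
      rw [map_inv, ← mul_assoc]
      exact mul_mem (Subgroup.normalClosure_normal.conj_mem _ (memB β) _) (memB β₁)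
    have hbb : β * β₁ ≠ 1 := by
      intro h
      rw [mul_eq_one_iff_inv_eq] at h
      subst h
      apply hUVA
      rw [map_inv, mul_assoc, ← mul_assoc (Monoid.CoprodI.of β)]
      exact mul_mem (memA α) (Subgroup.normalClosure_normal.conj_mem _ (memA α₁) _)
    obtain ⟨R, _, i, j, f, hi, hj, hf, h⟩ := P56.solv_case1 c₁ c₂ α α₁ β β₁ hc₁ hc₂ hc₁c₂
      hα hα₁ hβ hβ₁ haa hbb
    refine P56.nontrivial_of_hom i j f hf c₁ c₂ _ _ fun F h0 h1 => ?_
    rw [map_mul, map_mul]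
    rw [h0 α, h0 α₁, h1 β, h1 β₁]
    rw [← h]
    simp only [mul_assoc]
  · subst hV
    have haa : α⁻¹ * α₁ ≠ 1 := by
      intro h
      rw [inv_mul_eq_one] at h
      subst h
      apply hUVB
      rw [mul_inv_rev, mul_assoc, inv_mul_cancel_left]
      exact mul_mem (inv_mem (memB β)) (memB β₁)
    have hbb : β₁ * β⁻¹ ≠ 1 := by
      intro h
      rw [mul_inv_eq_one] at h
      subst h
      apply hUVA
      have := Subgroup.normalClosure_normal.conj_mem _ (mul_mem (inv_mem (memA α)) (memA α₁))
        (Monoid.CoprodI.of β₁)⁻¹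
      rw [inv_inv] at this
      rw [mul_inv_rev]
      simpa only [mul_assoc] using this
    obtain ⟨R, _, i, j, f, hf, h⟩ := P56.solv_case2 c₁ c₂ α⁻¹ α₁ β⁻¹ β₁ hc₁ hc₂ hc₁c₂
      (inv_ne_one.2 hα) hα₁ (inv_ne_one.2 hβ) hβ₁ haa hbb
    refine P56.nontrivial_of_hom i j f hf c₁ c₂ _ _ fun F h0 h1 => ?_
    rw [map_inv, map_mul, map_mul, mul_inv_rev]
    rw [h0 α, h0 α₁, h1 β, h1 β₁]
    rw [← map_inv i, ← map_inv j]
    exact h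
end

section
/- With the standing assumptions, suppose in addition that U = αβ or U = (αβ)⁻¹ and V = α₁β₁α₂, where α, α₁, α₂ are nontrivial elements of A and β, β₁ are nontrivial elements of B. Then G is nontrivial. -/
open Monoid

namespace P57
universe u v

theorem exists_cyc {P : Type u} [Group P] (x : P) (n : ℕ) (h : orderOf x = n) :
    ∃ f : Multiplicative (ZMod n) →* P, Function.Injective f ∧
      ∀ k : ℤ, f (Multiplicative.ofAdd (k : ZMod n)) = x ^ k := by
  have hx : (zmultiplesHom (Additive P) (Additive.ofMul x)) (n : ℤ) = 0 := by
    have : x ^ n = 1 := by rw [← h]; exact pow_orderOf_eq_one x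
    simpa using congrArg Additive.ofMul this
  let g : ZMod n →+ Additive P := ZMod.lift n ⟨zmultiplesHom (Additive P) (Additive.ofMul x), hx⟩
  have hg : ∀ k : ℤ, AddMonoidHom.toMultiplicativeLeft g (Multiplicative.ofAdd (k : ZMod n)) = x ^ k := by
    intro k
    have : g (k : ZMod n) = Additive.ofMul (x ^ k) := by
      simp only [g, ZMod.lift_coe]
      simp
    exact this
  refine ⟨AddMonoidHom.toMultiplicativeLeft g, ?_, hg⟩
  rw [injective_iff_map_eq_one]
  intro a ha
  obtain ⟨k, hk⟩ := ZMod.intCast_surjective (Multiplicative.toAdd a)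
  have e : a = Multiplicative.ofAdd (k : ZMod n) := by rw [hk]; rfl
  rw [e, hg] at ha
  rw [← orderOf_dvd_iff_zpow_eq_one, h] at ha
  rw [e, (ZMod.intCast_zmod_eq_zero_iff_dvd k n).2 ha]
  rfl

def Fam2 (P Q : Type u) : Bool → Type u := fun b => cond b P Q

instance Fam2.inst (P Q : Type u) [Group P] [Group Q] : ∀ b, Group (Fam2 P Q b)
  | true => inferInstanceAs (Group P)
  | false => inferInstanceAs (Group Q)

theorem exists_amalgam {P Q : Type u} {H : Type v} [Group P] [Group Q] [Group H]
    (i : H →* P) (j : H →* Q) (hi : Function.Injective i) (hj : Function.Injective j) :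
    ∃ (R : Type (max u v)) (_ : Group R) (f : P →* R) (g : Q →* R),
      Function.Injective f ∧ Function.Injective g ∧ ∀ h, f (i h) = g (j h) := by
  let φ : ∀ b, H →* Fam2 P Q b := fun b => match b with
    | true => i
    | false => j
  have hφ : ∀ b, Function.Injective (φ b) := by
    intro b; cases b
    · exact hj
    · exact hi
  refine ⟨PushoutI φ, inferInstance, PushoutI.of (φ := φ) true, PushoutI.of (φ := φ) false,
    PushoutI.of_injective hφ true, PushoutI.of_injective hφ false, fun h => ?_⟩
  exact (PushoutI.of_apply_eq_base φ true h).trans (PushoutI.of_apply_eq_base φ false h).symm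

/-- A group containing `P` and `Q`, acting on a set with first letter functions. -/
structure FP (P Q : Type u) [Group P] [Group Q] where
  R : Type u
  [grp : Group R]
  f : P →* R
  g : Q →* R
  S : Type u
  [act : MulAction R S]
  hP : S → P
  hQ : S → Q
  o : S
  hPo : hP o = 1
  hQo : hQ o = 1
  hPs : ∀ p w, hP (f p • w) = p * hP w
  hQs : ∀ q w, hQ (g q • w) = q * hQ w
  alt : ∀ w, hP w = 1 ∨ hQ w = 1

attribute [instance] FP.grp FP.act

theorem FP.nonempty (P Q : Type u) [Group P] [Group Q] : Nonempty (FP P Q) := by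
  classical
  let M := Fam2 P Q
  let _ : ∀ b, DecidableEq (M b) := fun b => Classical.decEq _
  have key : ∀ (b c : Bool) (w : CoprodI.Word M), b ≠ c → (CoprodI.Word.equivPair b w).head = 1 ∨
      (CoprodI.Word.equivPair c w).head = 1 := by
    intro b c w hbc
    by_cases h : w.fstIdx = some b
    · right
      rw [CoprodI.Word.equivPair_eq_of_fstIdx_ne]
      rw [h]; simpa using hbc
    · left
      rw [CoprodI.Word.equivPair_eq_of_fstIdx_ne h]
  refine ⟨{ R := CoprodI M, f := CoprodI.of (M := M) (i := true), g := CoprodI.of (M := M) (i := false), S := CoprodI.Word M,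
            hP := fun w => (CoprodI.Word.equivPair true w).head
            hQ := fun w => (CoprodI.Word.equivPair false w).head
            o := CoprodI.Word.empty, hPo := ?_, hQo := ?_, hPs := ?_, hQs := ?_, alt := ?_ }⟩
  · rw [CoprodI.Word.equivPair_eq_of_fstIdx_ne]; rfl
    simp [CoprodI.Word.fstIdx, CoprodI.Word.empty]
  · rw [CoprodI.Word.equivPair_eq_of_fstIdx_ne]; rfl
    simp [CoprodI.Word.fstIdx, CoprodI.Word.empty]
  · intro p w
    exact congrArg CoprodI.Word.Pair.head (CoprodI.Word.equivPair_smul_same (M := M) (i := true) p w)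
  · intro p w
    exact congrArg CoprodI.Word.Pair.head (CoprodI.Word.equivPair_smul_same (M := M) (i := false) p w)
  · intro w
    exact key true false w (by simp)

theorem FP.f_inj {P Q : Type u} [Group P] [Group Q] (X : FP P Q) : Function.Injective X.f := by
  rw [injective_iff_map_eq_one]
  intro a ha
  have := X.hPs a X.o
  rw [ha, one_smul, X.hPo] at this
  simpa using this.symm

theorem FP.g_inj {P Q : Type u} [Group P] [Group Q] (X : FP P Q) : Function.Injective X.g := by
  rw [injective_iff_map_eq_one]
  intro a ha
  have := X.hQs a X.o
  rw [ha, one_smul, X.hQo] at this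
  simpa using this.symm

/-- Ping-pong pairs. -/
def PP {P : Type u} [Group P] (x y : P) : Prop :=
  ∃ (S : Type u) (_ : MulAction P S) (X Y : Set S), X.Nonempty ∧ Y.Nonempty ∧ Disjoint X Y ∧
    (∀ k : ℤ, x ^ k ≠ 1 → ∀ s ∈ Y, x ^ k • s ∈ X) ∧ (∀ k : ℤ, y ^ k ≠ 1 → ∀ s ∈ X, y ^ k • s ∈ Y) ∧
    orderOf x = 0

theorem PP.inv_left {P : Type u} [Group P] {x y : P} (h : PP x y) : PP x⁻¹ y := by
  obtain ⟨S, i, X, Y, h1, h2, h3, h4, h5, h6⟩ := h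
  refine ⟨S, i, X, Y, h1, h2, h3, ?_, h5, by simpa using h6⟩
  intro k hk
  have := h4 (-k) (by simpa using hk)
  simpa using this

theorem PP.inv_right {P : Type u} [Group P] {x y : P} (h : PP x y) : PP x y⁻¹ := by
  obtain ⟨S, i, X, Y, h1, h2, h3, h4, h5, h6⟩ := h
  refine ⟨S, i, X, Y, h1, h2, h3, h4, ?_, h6⟩
  intro k hk
  have := h5 (-k) (by simpa using hk)
  simpa using this

theorem PP.exists_inj {P : Type u} [Group P] {x y : P} (h : PP x y) (n : Bool → ℕ)
    (hx : orderOf x = n true) (hy : orderOf y = n false) :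
    ∃ f : CoprodI (fun b => Multiplicative (ZMod (n b))) →* P, Function.Injective f ∧
      f (CoprodI.of (M := fun b => Multiplicative (ZMod (n b))) (i := true) (Multiplicative.ofAdd ((1 : ℤ) : ZMod (n true)))) = x ∧
      f (CoprodI.of (M := fun b => Multiplicative (ZMod (n b))) (i := false) (Multiplicative.ofAdd ((1 : ℤ) : ZMod (n false)))) = y := by
  obtain ⟨S, i, X, Y, h1, h2, h3, h4, h5, h6⟩ := h
  have := fun b => exists_cyc (cond b x y) (n b) (by cases b <;> assumption)
  choose f hfi hf using this
  refine ⟨CoprodI.lift f, ?_, ?_, ?_⟩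
  · refine CoprodI.lift_injective_of_ping_pong f ?_ (fun b => cond b X Y) ?_ ?_ ?_
    · right
      refine ⟨true, ?_⟩
      rw [← hx, h6]
      have : Infinite (Multiplicative (ZMod 0)) := inferInstanceAs (Infinite ℤ)
      refine le_trans ?_ (Cardinal.aleph0_le_mk _)
      exact_mod_cast (Cardinal.natCast_lt_aleph0 (n := 3)).le
    · intro b; cases b <;> assumption
    · intro b c hbc
      cases b <;> cases c <;> simp_all [Function.onFun]
      exact h3.symm
    · intro b c hbc h hh
      obtain ⟨k, hk⟩ := ZMod.intCast_surjective (Multiplicative.toAdd h)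
      have e : h = Multiplicative.ofAdd (k : ZMod (n b)) := by rw [hk]; rfl
      have hne : f b h ≠ 1 := by
        intro h0; exact hh ((injective_iff_map_eq_one (f b)).1 (hfi b) h h0)
      rw [e, hf] at hne
      rintro _ ⟨s, hs, rfl⟩
      change f b h • s ∈ _
      rw [e, hf]
      cases b <;> cases c <;> first | exact absurd rfl hbc | skip
      · exact h5 k hne s hs
      · exact h4 k hne s hs
  · rw [CoprodI.lift_of, hf]; simp
  · rw [CoprodI.lift_of, hf]; simp

theorem PP.amalgam {P Q : Type u} [Group P] [Group Q] {x y : P} {x' y' : Q} (h : PP x y)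
    (h' : PP x' y') (hy : orderOf y = orderOf y') :
    ∃ (R : Type u) (_ : Group R) (f : P →* R) (g : Q →* R),
      Function.Injective f ∧ Function.Injective g ∧ f x = g x' ∧ f y = g y' := by
  have hx : orderOf x = 0 := by obtain ⟨S, i, X, Y, h1, h2, h3, h4, h5, h6⟩ := h; exact h6
  have hx' : orderOf x' = 0 := by obtain ⟨S, i, X, Y, h1, h2, h3, h4, h5, h6⟩ := h'; exact h6
  obtain ⟨i, hi, i1, i2⟩ := h.exists_inj (fun b => cond b 0 (orderOf y)) hx rfl
  obtain ⟨j, hj, j1, j2⟩ := h'.exists_inj (fun b => cond b 0 (orderOf y)) hx' hy.symm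
  obtain ⟨R, _, f, g, hf, hg, hfg⟩ := exists_amalgam i j hi hj
  refine ⟨R, _, f, g, hf, hg, ?_, ?_⟩
  · rw [← i1, ← j1]; exact hfg _
  · rw [← i2, ← j2]; exact hfg _

theorem ping_zpow {P : Type u} {S : Type v} [Group P] [MulAction P S] (x : P) (X Y : Set S)
    (hXY : Disjoint X Y)
    (h1 : ∀ s, s ∉ Y → x • s ∈ X) (h2 : ∀ s, s ∉ X → x⁻¹ • s ∈ Y) :
    ∀ k : ℤ, k ≠ 0 → ∀ s, s ∉ X → s ∉ Y → x ^ k • s ∈ X ∪ Y := by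
  have hd : ∀ s, s ∈ X → s ∉ Y := fun s h => Set.disjoint_left.1 hXY h
  have hd' : ∀ s, s ∈ Y → s ∉ X := fun s h => Set.disjoint_right.1 hXY h
  have a1 : ∀ (n : ℕ) s, s ∉ Y → x ^ (n + 1) • s ∈ X := by
    intro n
    induction n with
    | zero => simpa using h1
    | succ n ih => intro s hs; rw [pow_succ', mul_smul]; exact h1 _ (hd _ (ih s hs))
  have a2 : ∀ (n : ℕ) s, s ∉ X → (x⁻¹) ^ (n + 1) • s ∈ Y := by
    intro n
    induction n with
    | zero => simpa using h2
    | succ n ih => intro s hs; rw [pow_succ', mul_smul]; exact h2 _ (hd' _ (ih s hs))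
  intro k hk s hsX hsY
  rcases k with k | k
  · obtain ⟨n, rfl⟩ : ∃ n, k = n + 1 := ⟨k - 1, by simp at hk; omega⟩
    left
    have := a1 n s hsY
    rwa [← zpow_natCast] at this
  · right
    simpa using a2 k s hsX

theorem orderOf_zero_of_ping {P : Type u} {S : Type v} [Group P] [MulAction P S] (x : P) (X Y : Set S)
    (hXY : Disjoint X Y)
    (h1 : ∀ s, s ∉ Y → x • s ∈ X) (h2 : ∀ s, s ∉ X → x⁻¹ • s ∈ Y) (o : S) (hX : o ∉ X) (hY : o ∉ Y) :
    orderOf x = 0 := by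
  by_contra h
  have := ping_zpow x X Y hXY h1 h2 (orderOf x) (by exact_mod_cast h) o hX hY
  rw [zpow_natCast, pow_orderOf_eq_one, one_smul] at this
  exact this.elim hX hY

/-- Four set ping-pong. -/
theorem PP.of_four {P S : Type u} [Group P] [MulAction P S] (x y : P) (X X' Y Y' : Set S)
    (o : S) (hoX : o ∉ X) (hoX' : o ∉ X') 
    (d1 : Disjoint X X') (d2 : Disjoint X Y) (d3 : Disjoint X Y') (d4 : Disjoint X' Y)
    (d5 : Disjoint X' Y') (d6 : Disjoint Y Y')
    (h1 : ∀ s, s ∉ X' → x • s ∈ X) (h2 : ∀ s, s ∉ X → x⁻¹ • s ∈ X')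
    (h3 : ∀ s, s ∉ Y' → y • s ∈ Y) (h4 : ∀ s, s ∉ Y → y⁻¹ • s ∈ Y') : PP x y := by
  have hx0 := h1 o hoX'
  have D : Disjoint (X ∪ X') (Y ∪ Y') := by
    simp only [Set.disjoint_union_left, Set.disjoint_union_right]; tauto
  refine ⟨S, inferInstance, X ∪ X', Y ∪ Y', ⟨_, Or.inl hx0⟩,
    ⟨y • (x • o), Or.inl (h3 _ (Set.disjoint_left.1 d3 hx0))⟩, D, ?_, ?_,
    orderOf_zero_of_ping x X X' d1 h1 h2 o hoX hoX'⟩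
  · intro k hk s hs
    have := Set.disjoint_right.1 D hs
    refine ping_zpow x X X' d1 h1 h2 k ?_ s (fun h => this (Or.inl h)) (fun h => this (Or.inr h))
    rintro rfl; simp at hk
  · intro k hk s hs
    have := Set.disjoint_left.1 D hs
    refine ping_zpow y Y Y' d6 h3 h4 k ?_ s (fun h => this (Or.inl h)) (fun h => this (Or.inr h))
    rintro rfl; simp at hk

end P57


namespace P57
universe u v

section pp
variable {P Q : Type u} [Group P] [Group Q] (X : FP P Q)

theorem FP.hQ_one {w : X.S} (h : X.hP w ≠ 1) : X.hQ w = 1 := (X.alt w).resolve_left h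
theorem FP.hP_one {w : X.S} (h : X.hQ w ≠ 1) : X.hP w = 1 := (X.alt w).resolve_right h

/-- If the last letter multiplies nontrivially, the next letter can be put in front. -/
theorem FP.hPQ (p : P) (q : Q) {w : X.S} (h : q * X.hQ w ≠ 1) : X.hP (X.f p • X.g q • w) = p := by
  rw [X.hPs, X.hP_one (by rwa [X.hQs]), mul_one]
theorem FP.hQP (p : P) (q : Q) {w : X.S} (h : p * X.hP w ≠ 1) : X.hQ (X.g q • X.f p • w) = q := by
  rw [X.hQs, X.hQ_one (by rwa [X.hPs]), mul_one]

theorem disj_P (p p' : P) (h : p ≠ p') : Disjoint {w | X.hP w = p} {w | X.hP w = p'} := by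
  rw [Set.disjoint_left]; intro w hw hw'; exact h (hw.symm.trans hw')
theorem disj_Q (q q' : Q) (h : q ≠ q') : Disjoint {w | X.hQ w = q} {w | X.hQ w = q'} := by
  rw [Set.disjoint_left]; intro w hw hw'; exact h (hw.symm.trans hw')
theorem disj_PQ (p : P) (q : Q) (h : p ≠ 1) (h' : q ≠ 1) : Disjoint {w | X.hP w = p} {w | X.hQ w = q} := by
  rw [Set.disjoint_left]; intro w hw hw'
  simp only [Set.mem_ofPred_eq] at hw hw'
  rcases X.alt w with h1 | h1
  · exact h (hw ▸ h1)
  · exact h' (hw' ▸ h1)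

theorem mul_ne_one_of {G : Type*} [Group G] {a b : G} (h : b ≠ a⁻¹) : a * b ≠ 1 :=
  fun e => h (eq_inv_of_mul_eq_one_right e)

theorem mul_ne_one_of' {G : Type*} [Group G] {a b : G} (h : b ≠ a) : a⁻¹ * b ≠ 1 :=
  fun e => h (inv_mul_eq_one.1 e).symm

theorem PP.pair (p p' : P) (q q' : Q) (hp : p ≠ 1) (hp' : p' ≠ 1) (hq : q ≠ 1) (hq' : q' ≠ 1)
    (hpp : p ≠ p') (hqq : q ≠ q') : PP (X.f p * X.g q) (X.f p' * X.g q') := by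
  refine PP.of_four _ _ {w | X.hP w = p} {w | X.hQ w = q⁻¹} {w | X.hP w = p'} {w | X.hQ w = q'⁻¹} X.o
    (by simpa [X.hPo] using hp.symm) (by simpa [X.hQo] using hq)
    (disj_PQ X _ _ hp (by simpa using hq)) (disj_P X _ _ hpp) (disj_PQ X _ _ hp (by simpa using hq'))
    (disj_PQ X _ _ hp' (by simpa using hq)).symm (disj_Q X _ _ (by simpa using hqq))
    (disj_PQ X _ _ hp' (by simpa using hq')) ?_ ?_ ?_ ?_
  · intro s hs
    rw [mul_smul]
    exact X.hPQ _ _ (mul_ne_one_of hs)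
  · intro s hs
    rw [mul_inv_rev, mul_smul, ← map_inv, ← map_inv]
    exact X.hQP _ _ (mul_ne_one_of' hs)
  · intro s hs
    rw [mul_smul]
    exact X.hPQ _ _ (mul_ne_one_of hs)
  · intro s hs
    rw [mul_inv_rev, mul_smul, ← map_inv, ← map_inv]
    exact X.hQP _ _ (mul_ne_one_of' hs)

theorem PP.triple (a a₁ a₂ : P) (b b₁ : Q) (ha : a ≠ 1) (ha₁ : a₁ ≠ 1) (ha₂ : a₂ ≠ 1) (hb : b ≠ 1)
    (hb₁ : b₁ ≠ 1) (h : a ≠ a₁) (h' : a ≠ a₂⁻¹) (h3x : a₁ ≠ a₂⁻¹) :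
    PP (X.f a * X.g b) (X.f a₁ * X.g b₁ * X.f a₂) := by
  have hb' : b⁻¹ ≠ 1 := by simpa using hb
  refine PP.of_four _ _ {w | X.hP w = a} {w | X.hQ w = b⁻¹} {w | X.hP w = a₁} {w | X.hP w = a₂⁻¹} X.o
    (by simpa [X.hPo] using ha.symm) (by simpa [X.hQo] using hb)
    (disj_PQ X _ _ ha hb') (disj_P X _ _ h) (disj_P X _ _ h') (disj_PQ X _ _ ha₁ hb').symm
    (disj_PQ X _ _ (by simpa using ha₂) hb').symm (disj_P X _ _ h3x) ?_ ?_ ?_ ?_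
  · intro s hs
    rw [mul_smul]
    exact X.hPQ _ _ (mul_ne_one_of hs)
  · intro s hs
    rw [mul_inv_rev, mul_smul, ← map_inv, ← map_inv]
    exact X.hQP _ _ (mul_ne_one_of' hs)
  · intro s hs
    rw [mul_smul, mul_smul]
    apply X.hPQ
    rw [X.hQ_one, mul_one]
    · exact hb₁
    · rw [X.hPs]; exact mul_ne_one_of hs
  · intro s hs
    rw [mul_inv_rev, mul_inv_rev, mul_smul, mul_smul, ← map_inv, ← map_inv, ← map_inv]
    apply X.hPQ
    rw [X.hQ_one, mul_one]
    · simpa using hb₁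
    · rw [X.hPs]; exact mul_ne_one_of' hs

theorem PP.pow (b b₁ : P) (a : Q) (hb₁ : b₁ ≠ 1) (ha : a ≠ 1) (hb : b ∉ Subgroup.zpowers b₁) :
    PP (X.f b * X.g a) (X.f b₁) := by
  have hb0 : b ≠ 1 := by rintro rfl; exact hb (one_mem _)
  have ha' : a⁻¹ ≠ 1 := by simpa using ha
  have d1 := disj_PQ X b a⁻¹ hb0 ha'
  have h1 : ∀ s, s ∉ {w | X.hQ w = a⁻¹} → (X.f b * X.g a) • s ∈ {w | X.hP w = b} := by
    intro s hs
    rw [mul_smul]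
    exact X.hPQ _ _ (mul_ne_one_of hs)
  have h2 : ∀ s, s ∉ {w | X.hP w = b} → (X.f b * X.g a)⁻¹ • s ∈ {w | X.hQ w = a⁻¹} := by
    intro s hs
    rw [mul_inv_rev, mul_smul, ← map_inv, ← map_inv]
    exact X.hQP _ _ (mul_ne_one_of' hs)
  have ho1 : X.o ∉ {w | X.hP w = b} := by simpa [X.hPo] using hb0.symm
  have ho2 : X.o ∉ {w | X.hQ w = a⁻¹} := by simpa [X.hQo] using ha
  have nP : ∀ k : ℤ, b₁ ^ k ≠ b := fun k e => hb (e ▸ Subgroup.zpow_mem_zpowers b₁ k)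
  have nP' : ∀ k : ℤ, b₁ ^ k * b ≠ 1 := fun k e => nP (-k) (by
    rw [zpow_neg]; exact inv_eq_of_mul_eq_one_right e)
  have hy : ∀ k : ℤ, (X.f b₁) ^ k ≠ 1 → b₁ ^ k ≠ 1 := by
    intro k hk e; rw [← map_zpow, e, map_one] at hk; exact hk rfl
  have HY : ∀ k : ℤ, (X.f b₁) ^ k ≠ 1 → ∀ s ∈ {w | X.hP w = b} ∪ {w | X.hQ w = a⁻¹},
      (X.f b₁) ^ k • s ∈ {w | ∃ k : ℤ, b₁ ^ k ≠ 1 ∧ (X.hP w = b₁ ^ k ∨ X.hP w = b₁ ^ k * b)} := by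
    intro k hk s hs
    refine ⟨k, hy k hk, ?_⟩
    rw [← map_zpow, X.hPs]
    rcases hs with hs | hs
    · right; rw [hs]
    · left
      rw [X.hP_one, mul_one]
      rw [hs]; exact ha'
  have hf1 : (X.f b₁) ^ (1 : ℤ) ≠ 1 := by
    rw [zpow_one]; intro e; exact hb₁ ((injective_iff_map_eq_one X.f).1 X.f_inj _ e)
  refine ⟨X.S, inferInstance, {w | X.hP w = b} ∪ {w | X.hQ w = a⁻¹},
    {w | ∃ k : ℤ, b₁ ^ k ≠ 1 ∧ (X.hP w = b₁ ^ k ∨ X.hP w = b₁ ^ k * b)},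
    ⟨_, Or.inl (h1 _ ho2)⟩, ⟨_, HY 1 hf1 _ (Or.inl (h1 _ ho2))⟩, ?_, ?_, HY,
    orderOf_zero_of_ping _ _ _ d1 h1 h2 X.o ho1 ho2⟩
  · rw [Set.disjoint_left]
    rintro w (hw | hw) ⟨k, hk, hk'⟩
    · rw [hw] at hk'
      rcases hk' with e | e
      · exact nP k e.symm
      · exact hk (mul_eq_right.1 e.symm)
    · have : X.hP w = 1 := X.hP_one (by rw [hw]; exact ha')
      rw [this] at hk'
      rcases hk' with e | e
      · exact hk e.symm
      · exact nP' k e.symm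
  · rintro k hk s ⟨j, hj, hj'⟩
    refine ping_zpow _ _ _ d1 h1 h2 k ?_ s ?_ ?_
    · rintro rfl; simp at hk
    · intro e
      rw [e] at hj'
      rcases hj' with e | e
      · exact nP j e.symm
      · exact hj (mul_eq_right.1 e.symm)
    · intro e
      have : X.hP s = 1 := X.hP_one (by rw [e]; exact ha')
      rw [this] at hj'
      rcases hj' with e | e
      · exact hj e.symm
      · exact nP' j e.symm

theorem PP.solve (c₁ c₂ : P) (v : Q) (hc₁ : c₁ ≠ 1) (hc₂ : c₂ ≠ 1) (hcc : c₁ * c₂ ≠ 1) (hv : v ≠ 1) :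
    PP (X.f c₁⁻¹ * X.g v⁻¹ * X.f c₂⁻¹) (X.g v) := by
  have hc₁' : c₁⁻¹ ≠ 1 := by simpa using hc₁
  have d1 : Disjoint {w | X.hP w = c₁⁻¹} {w | X.hP w = c₂} :=
    disj_P X _ _ (fun e => hcc (by rw [← e]; simp))
  have h1 : ∀ s, s ∉ {w | X.hP w = c₂} →
      (X.f c₁⁻¹ * X.g v⁻¹ * X.f c₂⁻¹) • s ∈ {w | X.hP w = c₁⁻¹} := by
    intro s hs
    rw [mul_smul, mul_smul]
    apply X.hPQ
    rw [X.hQ_one, mul_one]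
    · simpa using hv
    · rw [X.hPs]; exact mul_ne_one_of' hs
  have h2 : ∀ s, s ∉ {w | X.hP w = c₁⁻¹} →
      (X.f c₁⁻¹ * X.g v⁻¹ * X.f c₂⁻¹)⁻¹ • s ∈ {w | X.hP w = c₂} := by
    intro s hs
    have : (X.f c₁⁻¹ * X.g v⁻¹ * X.f c₂⁻¹)⁻¹ = X.f c₂ * (X.g v * X.f c₁) := by
      simp [mul_assoc]
    rw [this, mul_smul, mul_smul]
    apply X.hPQ
    rw [X.hQ_one, mul_one]
    · exact hv
    · rw [X.hPs]; exact mul_ne_one_of hs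
  have ho1 : X.o ∉ {w | X.hP w = c₁⁻¹} := by
    intro e; exact hc₁' (e.symm.trans X.hPo)
  have ho2 : X.o ∉ {w | X.hP w = c₂} := by
    intro e; exact hc₂ (e.symm.trans X.hPo)
  have hne : ∀ s ∈ {w | X.hP w = c₁⁻¹} ∪ {w | X.hP w = c₂}, X.hP s ≠ 1 := by
    rintro s (e | e)
    · rw [e]; exact hc₁'
    · rw [e]; exact hc₂
  have HY : ∀ k : ℤ, (X.g v) ^ k ≠ 1 → ∀ s ∈ {w | X.hP w = c₁⁻¹} ∪ {w | X.hP w = c₂},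
      (X.g v) ^ k • s ∈ {w | X.hQ w ≠ 1} := by
    intro k hk s hs
    change X.hQ _ ≠ 1
    rw [← map_zpow, X.hQs, X.hQ_one (hne s hs), mul_one]
    intro e; rw [← map_zpow, e, map_one] at hk; exact hk rfl
  have hf1 : (X.g v) ^ (1 : ℤ) ≠ 1 := by
    rw [zpow_one]; intro e; exact hv ((injective_iff_map_eq_one X.g).1 X.g_inj _ e)
  refine ⟨X.S, inferInstance, {w | X.hP w = c₁⁻¹} ∪ {w | X.hP w = c₂}, {w | X.hQ w ≠ 1},
    ⟨_, Or.inl (h1 _ ho2)⟩, ⟨_, HY 1 hf1 _ (Or.inl (h1 _ ho2))⟩, ?_, ?_, HY,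
    orderOf_zero_of_ping _ _ _ d1 h1 h2 X.o ho1 ho2⟩
  · rw [Set.disjoint_left]
    intro w hw hw'
    exact hw' (X.hQ_one (hne w hw))
  · intro k hk s hs
    have := X.hP_one hs
    refine ping_zpow _ _ _ d1 h1 h2 k ?_ s ?_ ?_
    · rintro rfl; simp at hk
    · intro e; exact hc₁' (e.symm.trans this)
    · intro e; exact hc₂ (e.symm.trans this)

end pp

/-- The relation `c₁ U c₂ V = 1` can be solved over `P` if `U, V` form a ping-pong pair. -/
theorem PP.main {P C : Type u} [Group P] [Group C] {U V : P} (h : PP U V) (hV : V ≠ 1) (c₁ c₂ : C)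
    (hc₁ : c₁ ≠ 1) (hc₂ : c₂ ≠ 1) (hcc : c₁ * c₂ ≠ 1) :
    ∃ (R : Type u) (_ : Group R) (f : P →* R) (g : C →* R), Function.Injective f ∧
      g c₁ * f U * g c₂ * f V = 1 := by
  obtain ⟨X⟩ := FP.nonempty C P
  obtain ⟨R, _, f, g, hf, hg, e1, e2⟩ := h.amalgam (PP.solve X c₁ c₂ V hc₁ hc₂ hcc hV)
    (orderOf_injective X.g X.g_inj V).symm
  refine ⟨R, _, f, g.comp X.f, hf, ?_⟩
  rw [e1, e2]
  simp only [MonoidHom.comp_apply, ← map_mul, map_inv]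
  convert map_one g
  group

/-- Cyclic amalgamation. -/
theorem exists_ext {A Q : Type u} [Group A] [Group Q] (a : A) (q : Q) (h : orderOf a = orderOf q) :
    ∃ (R : Type u) (_ : Group R) (f : A →* R) (g : Q →* R),
      Function.Injective f ∧ Function.Injective g ∧ f a = g q := by
  obtain ⟨i, hi, hi'⟩ := exists_cyc a _ rfl
  obtain ⟨j, hj, hj'⟩ := exists_cyc q _ h.symm
  obtain ⟨R, _, f, g, hf, hg, hfg⟩ := exists_amalgam i j hi hj
  refine ⟨R, _, f, g, hf, hg, ?_⟩
  have := hfg (Multiplicative.ofAdd ((1 : ℤ) : ZMod (orderOf a)))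
  rwa [hi', hj', zpow_one, zpow_one] at this

theorem exists_ext3 {A B C Q : Type u} [Group A] [Group B] [Group C] [Group Q] (a : A) (b : B) (c : C)
    (x y z : Q) (hx : orderOf x = orderOf a) (hy : orderOf y = orderOf b) (hz : orderOf z = orderOf c) :
    ∃ (R : Type u) (_ : Group R) (f : A →* R) (g : B →* R) (h : C →* R) (t : Q →* R),
      Function.Injective f ∧ f a = t x ∧ g b = t y ∧ h c = t z := by
  obtain ⟨R₁, _, f₁, g₁, hf₁, hg₁, e₁⟩ := exists_ext a x hx.symm
  obtain ⟨R₂, _, f₂, g₂, hf₂, hg₂, e₂⟩ := exists_ext b (g₁ y) (by rw [orderOf_injective g₁ hg₁, hy])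
  obtain ⟨R₃, _, f₃, g₃, hf₃, hg₃, e₃⟩ := exists_ext c (g₂ (g₁ z))
    (by rw [orderOf_injective g₂ hg₂, orderOf_injective g₁ hg₁, hz])
  refine ⟨R₃, _, (g₃.comp g₂).comp f₁, g₃.comp f₂, f₃, (g₃.comp g₂).comp g₁, ?_, ?_, ?_, ?_⟩
  · exact (hg₃.comp hg₂).comp hf₁
  · simp [e₁]
  · simp [e₂]
  · simp [e₃]

/-- Adjoining a square root. -/
theorem exists_sqrt {A : Type u} [Group A] (a : A) :
    ∃ (R : Type u) (_ : Group R) (f : A →* R) (x : R), Function.Injective f ∧ x * x = f a := by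
  let K := ULift.{u} (Multiplicative (ZMod (2 * orderOf a)))
  let x : K := ⟨Multiplicative.ofAdd 1⟩
  have hx : orderOf x = 2 * orderOf a := by
    have : orderOf x = orderOf (Multiplicative.ofAdd (1 : ZMod (2 * orderOf a))) :=
      (orderOf_injective (MulEquiv.ulift : K ≃* Multiplicative (ZMod (2 * orderOf a))).toMonoidHom
        (MulEquiv.ulift : K ≃* Multiplicative (ZMod (2 * orderOf a))).injective x).symm
    rw [this, orderOf_ofAdd_eq_addOrderOf, ZMod.addOrderOf_one]
  have hx2 : orderOf (x ^ 2) = orderOf a := by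
    rw [orderOf_pow' x (by norm_num), hx, Nat.gcd_eq_right (Dvd.intro _ rfl)]
    simp
  obtain ⟨R, _, f, g, hf, hg, e⟩ := exists_ext a (x ^ 2) hx2.symm
  refine ⟨R, _, f, g x, hf, ?_⟩
  rw [e, map_pow, pow_two]

end P57

namespace P57
universe u v
section mat
open Matrix

theorem exists_lam (n : ℕ) (hn : n ≠ 1) : ∃ l : ℂ, l ≠ 0 ∧ l ^ 2 ≠ 1 ∧ orderOf (l ^ 2) = n := by
  have : ∃ z : ℂ, z ≠ 0 ∧ orderOf z = n := by
    rcases Nat.eq_zero_or_pos n with rfl | h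
    · refine ⟨2, by norm_num, ?_⟩
      rw [orderOf_eq_zero_iff']
      intro k hk h
      have := congrArg norm h
      rw [norm_pow, norm_one, Complex.norm_two] at this
      exact (one_lt_pow₀ one_lt_two hk.ne').ne' this
    · have := Complex.isPrimitiveRoot_exp n h.ne'
      exact ⟨_, this.ne_zero h.ne', this.eq_orderOf.symm⟩
  obtain ⟨z, h0, hz⟩ := this
  obtain ⟨l, hl⟩ := IsAlgClosed.exists_pow_nat_eq z (n := 2) (by norm_num)
  refine ⟨l, ?_, ?_, by rw [hl, hz]⟩
  · rintro rfl; simp at hl; exact h0 hl.symm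
  · intro h; rw [hl] at h; rw [h, orderOf_one] at hz; exact hn hz.symm

abbrev SL := Matrix.SpecialLinearGroup (Fin 2) ℂ
abbrev PSL := SL ⧸ Subgroup.center SL

theorem sl_sq (M : SL) (l m : ℂ) (hlm : l * m = 1) (ht : (M : Matrix (Fin 2) (Fin 2) ℂ).trace = l + m) :
    (M : Matrix (Fin 2) (Fin 2) ℂ) * M = (l + m) • (M : Matrix (Fin 2) (Fin 2) ℂ) - 1 := by
  have hd := M.det_coe
  rw [det_fin_two] at hd
  rw [trace_fin_two] at ht
  rw [← ht]
  ext i j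
  fin_cases i <;> fin_cases j <;> simp [Matrix.mul_apply, Fin.sum_univ_two] <;> first | ring1 | linear_combination hd | linear_combination (-1 : ℂ) * hd

theorem sl_pow (M : SL) (l m : ℂ) (hlm : l * m = 1) (ht : (M : Matrix (Fin 2) (Fin 2) ℂ).trace = l + m) (n : ℕ) :
    (l - m) • (M : Matrix (Fin 2) (Fin 2) ℂ) ^ (n + 1) =
      (l ^ (n + 1) - m ^ (n + 1)) • (M : Matrix (Fin 2) (Fin 2) ℂ) - (l ^ n - m ^ n) • (1 : Matrix (Fin 2) (Fin 2) ℂ) := by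
  induction n with
  | zero => simp
  | succ n ih =>
    rw [pow_succ, ← smul_mul_assoc, ih, sub_mul, smul_mul_assoc, smul_mul_assoc, one_mul,
      sl_sq M l m hlm ht, smul_sub, smul_smul, sub_right_comm, ← sub_smul]
    congr 2
    linear_combination (l ^ n - m ^ n) * hlm

theorem psl_order (M : SL) (l : ℂ) (h0 : l ≠ 0) (h1 : l ^ 2 ≠ 1)
    (ht : (M : Matrix (Fin 2) (Fin 2) ℂ).trace = l + l⁻¹) :
    orderOf (QuotientGroup.mk M : PSL) = orderOf (l ^ 2) := by
  obtain ⟨m, hm⟩ : ∃ m, m = l⁻¹ := ⟨_, rfl⟩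
  have hlm : l * m = 1 := by rw [hm]; exact mul_inv_cancel₀ h0
  rw [← hm] at ht
  have hne : l - m ≠ 0 := by
    intro h; apply h1
    linear_combination l * h + hlm
  rw [orderOf_eq_orderOf_iff]
  intro n
  rcases n with _ | n
  · simp
  rw [← QuotientGroup.mk_pow, QuotientGroup.eq_one_iff, Matrix.SpecialLinearGroup.mem_center_iff]
  have key := sl_pow M l m hlm ht n
  have e : (l ^ 2) ^ (n + 1) = 1 ↔ l ^ (n + 1) - m ^ (n + 1) = 0 := by
    have h2 : l ^ (n + 1) * m ^ (n + 1) = 1 := by rw [← mul_pow, hlm, one_pow]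
    have h3 : l ^ (n + 1) ≠ 0 := pow_ne_zero _ h0
    rw [← pow_mul, mul_comm 2, pow_mul]
    constructor
    · intro h
      apply mul_left_cancel₀ h3
      linear_combination h - h2
    · intro h
      linear_combination l ^ (n + 1) * h + h2
  rw [e]
  have hd := M.det_coe
  rw [det_fin_two] at hd
  rw [trace_fin_two] at ht
  constructor
  · rintro ⟨r, hr, hs⟩
    by_contra hS
    rw [Matrix.SpecialLinearGroup.coe_pow] at hs
    rw [← hs] at key
    have k01 := congrFun (congrFun key 0) 1
    have k10 := congrFun (congrFun key 1) 0
    have k00 := congrFun (congrFun key 0) 0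
    have k11 := congrFun (congrFun key 1) 1
    simp at k01 k10 k00 k11
    have z01 : (M : Matrix (Fin 2) (Fin 2) ℂ) 0 1 = 0 := by
      rcases k01 with h | h
      · exact absurd h hS
      · exact h
    have zz : (M : Matrix (Fin 2) (Fin 2) ℂ) 0 0 = (M : Matrix (Fin 2) (Fin 2) ℂ) 1 1 := by
      apply mul_left_cancel₀ hS
      linear_combination k11 - k00
    rw [z01, zz] at hd
    rw [zz] at ht
    have : (l - m) ^ 2 = 0 := by
      linear_combination (-(l+m) - 2 * (M : Matrix (Fin 2) (Fin 2) ℂ) 1 1) * ht - 4 * hlm + 4 * hd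
    exact hne (pow_eq_zero_iff (by norm_num) |>.1 this)
  · intro hS
    rw [hS, zero_smul, zero_sub] at key
    have hs : ((M ^ (n + 1) : SL) : Matrix (Fin 2) (Fin 2) ℂ) = scalar (Fin 2) (-(l ^ n - m ^ n) / (l - m)) := by
      rw [Matrix.SpecialLinearGroup.coe_pow]
      have : (l - m)⁻¹ • ((l - m) • (M : Matrix (Fin 2) (Fin 2) ℂ) ^ (n + 1)) = (l - m)⁻¹ • (-((l ^ n - m ^ n) • (1 : Matrix (Fin 2) (Fin 2) ℂ))) := by rw [key]
      rw [smul_smul, inv_mul_cancel₀ hne, one_smul] at this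
      rw [this]
      ext i j
      fin_cases i <;> fin_cases j <;> simp <;> ring
    refine ⟨_, ?_, hs.symm⟩
    have := (M ^ (n + 1)).det_coe
    rw [hs] at this
    rwa [scalar_apply, det_diagonal, Finset.prod_const, Finset.card_univ] at this

noncomputable def mU (l : ℂ) (h : l ≠ 0) : SL := ⟨!![l, 1; 0, l⁻¹], by simp [det_fin_two, h]⟩
noncomputable def mL (l : ℂ) (h : l ≠ 0) (s : ℂ) : SL := ⟨!![l, 0; s, l⁻¹], by simp [det_fin_two, h]⟩

theorem mU_zpow (l : ℂ) (h : l ≠ 0) (k : ℤ) : ∃ p q r : ℂ,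
    ((mU l h ^ k : SL) : Matrix (Fin 2) (Fin 2) ℂ) = !![p, q; 0, r] := by
  induction k using Int.induction_on with
  | zero => exact ⟨1, 0, 1, by simp [one_fin_two]⟩
  | succ n ih =>
    obtain ⟨p, q, r, ih⟩ := ih
    refine ⟨p * l, p + q * l⁻¹, r * l⁻¹, ?_⟩
    rw [_root_.zpow_add_one, Matrix.SpecialLinearGroup.coe_mul, ih]
    simp [mU]
  | pred n ih =>
    obtain ⟨p, q, r, ih⟩ := ih
    refine ⟨p * l⁻¹, -p + q * l, r * l, ?_⟩
    rw [_root_.zpow_sub_one, Matrix.SpecialLinearGroup.coe_mul, ih, Matrix.SpecialLinearGroup.coe_inv]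
    simp [mU, adjugate_fin_two]

theorem mL_zpow (l : ℂ) (h : l ≠ 0) (k : ℤ) : ∃ p q r : ℂ, ∀ s,
    ((mL l h s ^ k : SL) : Matrix (Fin 2) (Fin 2) ℂ) = !![p, 0; q * s, r] := by
  induction k using Int.induction_on with
  | zero => exact ⟨1, 0, 1, by simp [one_fin_two]⟩
  | succ n ih =>
    obtain ⟨p, q, r, ih⟩ := ih
    refine ⟨p * l, q * l + r, r * l⁻¹, fun s => ?_⟩
    rw [_root_.zpow_add_one, Matrix.SpecialLinearGroup.coe_mul, ih]
    simp [mL]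
    ring
  | pred n ih =>
    obtain ⟨p, q, r, ih⟩ := ih
    refine ⟨p * l⁻¹, q * l⁻¹ - r, r * l, fun s => ?_⟩
    rw [_root_.zpow_sub_one, Matrix.SpecialLinearGroup.coe_mul, ih, Matrix.SpecialLinearGroup.coe_inv]
    simp [mL, adjugate_fin_two]
    ring

theorem mU_order (l : ℂ) (h : l ≠ 0) (h1 : l ^ 2 ≠ 1) :
    orderOf (QuotientGroup.mk (mU l h) : PSL) = orderOf (l ^ 2) :=
  psl_order _ l h h1 (by simp [mU, trace_fin_two])

theorem mL_order (l : ℂ) (h : l ≠ 0) (h1 : l ^ 2 ≠ 1) (s : ℂ) :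
    orderOf (QuotientGroup.mk (mL l h s) : PSL) = orderOf (l ^ 2) :=
  psl_order _ l h h1 (by simp [mL, trace_fin_two])

/-- A power of an element of `SL` which is diagonal and commutes with a non-diagonal triangular one
is central. -/
theorem mem_center_of_diag (M : SL) (p r : ℂ) (hM : (M : Matrix (Fin 2) (Fin 2) ℂ) = !![p, 0; 0, r]) (h : p = r) :
    M ∈ Subgroup.center SL := by
  rw [Matrix.SpecialLinearGroup.mem_center_iff]
  subst h
  have hs : (M : Matrix (Fin 2) (Fin 2) ℂ) = scalar (Fin 2) p := by
    rw [hM]; ext i j; fin_cases i <;> fin_cases j <;> simp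
  refine ⟨p, ?_, hs.symm⟩
  have := M.det_coe
  rw [hs] at this
  simpa using this

theorem mU_zpow' (l : ℂ) (h : l ≠ 0) (h1 : l ^ 2 ≠ 1) (k : ℤ) (hk : ¬ (orderOf (l ^ 2) : ℤ) ∣ k) : ∃ p q r : ℂ,
    q ≠ 0 ∧ ((mU l h ^ k : SL) : Matrix (Fin 2) (Fin 2) ℂ) = !![p, q; 0, r] := by
  obtain ⟨p, q, r, H⟩ := mU_zpow l h k
  refine ⟨p, q, r, ?_, H⟩
  rintro rfl
  apply hk
  rw [← mU_order l h h1, orderOf_dvd_iff_zpow_eq_one, ← QuotientGroup.mk_zpow, QuotientGroup.eq_one_iff]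
  apply mem_center_of_diag _ p r H
  have c : (mU l h ^ k) * mU l h = mU l h * (mU l h ^ k) := by
    rw [← _root_.zpow_add_one, ← _root_.zpow_one_add, add_comm]
  have c' := congrArg (fun M : SL => (M : Matrix (Fin 2) (Fin 2) ℂ) 0 1) c
  simp only [Matrix.SpecialLinearGroup.coe_mul, H] at c'
  simpa [mU] using c'

theorem mL_zpow' (l : ℂ) (h : l ≠ 0) (h1 : l ^ 2 ≠ 1) (k : ℤ) (hk : ¬ (orderOf (l ^ 2) : ℤ) ∣ k) : ∃ p q r : ℂ,
    q ≠ 0 ∧ ∀ s, ((mL l h s ^ k : SL) : Matrix (Fin 2) (Fin 2) ℂ) = !![p, 0; q * s, r] := by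
  obtain ⟨p, q, r, H⟩ := mL_zpow l h k
  refine ⟨p, q, r, ?_, H⟩
  rintro rfl
  apply hk
  have H := H 1
  rw [zero_mul] at H
  rw [← mL_order l h h1 1, orderOf_dvd_iff_zpow_eq_one, ← QuotientGroup.mk_zpow, QuotientGroup.eq_one_iff]
  apply mem_center_of_diag _ p r H
  have c : (mL l h 1 ^ k) * mL l h 1 = mL l h 1 * (mL l h 1 ^ k) := by
    rw [← _root_.zpow_add_one, ← _root_.zpow_one_add, add_comm]
  have c' := congrArg (fun M : SL => (M : Matrix (Fin 2) (Fin 2) ℂ) 1 0) c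
  simp only [Matrix.SpecialLinearGroup.coe_mul, H] at c'
  simpa [mL] using c'.symm

theorem exists_triangle (n₁ n₂ n₃ : ℕ) (h₁ : n₁ ≠ 1) (h₂ : n₂ ≠ 1) (h₃ : n₃ ≠ 1) :
    ∃ x y : PSL, orderOf x = n₁ ∧ orderOf y = n₂ ∧ orderOf (x * y) = n₃ := by
  obtain ⟨l, l0, l1, rfl⟩ := exists_lam n₁ h₁
  obtain ⟨m, m0, m1, rfl⟩ := exists_lam n₂ h₂
  obtain ⟨r, r0, r1, rfl⟩ := exists_lam n₃ h₃
  refine ⟨QuotientGroup.mk (mU l l0), QuotientGroup.mk (mL m m0 (r + r⁻¹ - l * m - l⁻¹ * m⁻¹)),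
    mU_order _ _ l1, mL_order _ _ m1 _, ?_⟩
  rw [← QuotientGroup.mk_mul]
  refine psl_order _ r r0 r1 ?_
  rw [Matrix.SpecialLinearGroup.coe_mul]
  simp [mU, mL, trace_fin_two]
  ring

theorem exists_quad_root (a b c : ℂ) (ha : a ≠ 0) : ∃ s, a * s ^ 2 + b * s + c = 0 := by
  obtain ⟨d, hd⟩ := IsAlgClosed.exists_pow_nat_eq (b ^ 2 - 4 * a * c) (n := 2) (by norm_num)
  refine ⟨(-b + d) / (2 * a), ?_⟩
  field_simp
  linear_combination hd

theorem exists_quad (n₁ n₂ n₃ : ℕ) (h₁ : n₁ ≠ 1) (h₂ : n₂ ≠ 1) (h₃ : n₃ ≠ 1) (j k : ℤ)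
    (hj : ¬ (n₁ : ℤ) ∣ j) (hk : ¬ (n₂ : ℤ) ∣ k) :
    ∃ x y : PSL, orderOf x = n₁ ∧ orderOf y = n₂ ∧ orderOf (x ^ j * y ^ k * x * y) = n₃ := by
  obtain ⟨l, l0, l1, rfl⟩ := exists_lam n₁ h₁
  obtain ⟨m, m0, m1, rfl⟩ := exists_lam n₂ h₂
  obtain ⟨r, r0, r1, rfl⟩ := exists_lam n₃ h₃
  obtain ⟨p, q, t, hq, H⟩ := mU_zpow' l l0 l1 j hj
  obtain ⟨p', q', t', hq', H'⟩ := mL_zpow' m m0 m1 k hk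
  have tr : ∀ s, ((mU l l0 ^ j * mL m m0 s ^ k * mU l l0 * mL m m0 s : SL) : Matrix (Fin 2) (Fin 2) ℂ).trace =
      q * q' * s ^ 2 + (p * p' + q * q' * l * m + q * t' * l⁻¹ + t * q' * m⁻¹) * s +
       (p * p' * l * m + t * t' * l⁻¹ * m⁻¹) := by
    intro s
    rw [Matrix.SpecialLinearGroup.coe_mul, Matrix.SpecialLinearGroup.coe_mul, Matrix.SpecialLinearGroup.coe_mul, H, H']
    simp [mU, mL, trace_fin_two]
    ring
  obtain ⟨s, hs⟩ := exists_quad_root (q * q') (p * p' + q * q' * l * m + q * t' * l⁻¹ + t * q' * m⁻¹)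
    (p * p' * l * m + t * t' * l⁻¹ * m⁻¹ - (r + r⁻¹)) (mul_ne_zero hq hq')
  refine ⟨QuotientGroup.mk (mU l l0), QuotientGroup.mk (mL m m0 s),
    mU_order _ _ l1, mL_order _ _ m1 _, ?_⟩
  rw [← QuotientGroup.mk_zpow, ← QuotientGroup.mk_zpow, ← QuotientGroup.mk_mul, ← QuotientGroup.mk_mul, ← QuotientGroup.mk_mul]
  refine psl_order _ r r0 r1 ?_
  rw [tr]
  linear_combination hs

end mat
end P57

namespace P57
universe u v

theorem FP.ne_one {P Q : Type u} [Group P] [Group Q] (X : FP P Q) (p : P) (q : Q) (hq : q ≠ 1) :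
    X.f p * X.g q ≠ 1 := by
  intro h
  have h1 := X.hPQ p q (w := X.o) (by simpa [X.hQo] using hq)
  rw [← mul_smul, h, one_smul, X.hPo] at h1
  rw [← h1, map_one, one_mul] at h
  exact hq (X.g_inj (h.trans (map_one _).symm))

/-- Conjugation as an endomorphism. -/
def cj {R : Type u} [Group R] (r : R) : R →* R := (MulAut.conj r).toMonoidHom

theorem cj_apply {R : Type u} [Group R] (r x : R) : cj r x = r * x * r⁻¹ := rfl

theorem cj_inj {R : Type u} [Group R] (r : R) : Function.Injective (cj r) := (MulAut.conj r).injective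

/-- There is a group receiving the three factors, injectively on the first one, in which the
relation holds. -/
def Sol {A B C : Type u} [Group A] [Group B] [Group C] (a a₁ a₂ : A) (b b₁ : B) (c₁ c₂ : C) : Prop :=
  ∃ (R : Type u) (_ : Group R) (f : A →* R) (g : B →* R) (h : C →* R), Function.Injective f ∧
    h c₁ * f a * g b * h c₂ * f a₁ * g b₁ * f a₂ = 1

section cases
variable {A B C : Type u} [Group A] [Group B] [Group C]

theorem rot {G : Type u} [Group G] {x y : G} (r : G) (h : y = 1) (e : x = r * y * r⁻¹) : x = 1 := by
  rw [e, h]; group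

theorem sol_i1 (a a₁ : A) (b b₁ : B) (c₁ c₂ : C) (ha : a ≠ 1) (ha₁ : a₁ ≠ 1) (hb : b ≠ 1)
    (hb₁ : b₁ ≠ 1) (hc₁ : c₁ ≠ 1) (hc₂ : c₂ ≠ 1) (hc : c₁ * c₂ ≠ 1) (hbb : b * b₁ ≠ 1) (h : a ≠ a₁) :
    Sol a a₁ a₁⁻¹ b b₁ c₁ c₂ := by
  obtain ⟨X⟩ := FP.nonempty A C
  have hp : PP (X.f a₁ * X.g c₂) (X.f (a * a₁⁻¹)⁻¹ * X.g c₁⁻¹) := by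
    apply PP.pair X _ _ _ _ ha₁ _ hc₂ (by simpa using hc₁)
    · simpa using ha
    · exact fun e => hc (by rw [e]; simp)
    · simpa [mul_inv_eq_one] using h.symm
  obtain ⟨R, _, F, k, hF, e⟩ := hp.inv_right.main
    (by rw [Ne, inv_eq_one]; exact X.ne_one _ _ (by simpa using hc₁)) b b₁ hb hb₁ hbb
  refine ⟨R, _, F.comp X.f, (cj (F (X.f a₁⁻¹))).comp k, F.comp X.g,
    hF.comp X.f_inj, ?_⟩
  simp only [MonoidHom.comp_apply, cj_apply]
  simp only [map_mul, map_inv] at e ⊢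
  refine rot (F (X.g c₁) * F (X.f a) * (F (X.f a₁))⁻¹) e ?_
  group

theorem sol_i2 (a a₁ a₂ : A) (b b₁ : B) (c₁ c₂ : C) (ha : a ≠ 1) (ha₁ : a₁ ≠ 1) (ha₂ : a₂ ≠ 1)
    (hb : b ≠ 1) (hb₁ : b₁ ≠ 1) (hc₁ : c₁ ≠ 1) (hc₂ : c₂ ≠ 1) (hc : c₁ * c₂ ≠ 1) (h : a ≠ a₁)
    (h' : a ≠ a₂⁻¹) (h3x : a₁ ≠ a₂⁻¹) :
    Sol a a₁ a₂ b b₁ c₁ c₂ := by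
  obtain ⟨X⟩ := FP.nonempty A B
  obtain ⟨R, _, F, k, hF, e⟩ := (PP.triple X a a₁ a₂ b b₁ ha ha₁ ha₂ hb hb₁ h h' h3x).main
    (by
      intro e
      refine X.ne_one (a₂ * a₁) b₁ hb₁ ?_
      refine rot (X.f a₂) e ?_
      simp only [map_mul]; group) c₁ c₂ hc₁ hc₂ hc
  refine ⟨R, _, F.comp X.f, F.comp X.g, k, hF.comp X.f_inj, ?_⟩
  simp only [MonoidHom.comp_apply, map_mul] at e ⊢
  simpa only [mul_assoc] using e

theorem sol_i3 (a a₁ : A) (b b₁ : B) (c₁ c₂ : C) (ha : a ≠ 1) (ha₁ : a₁ ≠ 1) (hb : b ≠ 1)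
    (hb₁ : b₁ ≠ 1) (hc₁ : c₁ ≠ 1) (hc₂ : c₂ ≠ 1) (hc : c₁ * c₂ ≠ 1) (hbb : b * b₁ ≠ 1) (h : a ≠ a₁) :
    Sol a a₁ a⁻¹ b b₁ c₁ c₂ := by
  obtain ⟨X⟩ := FP.nonempty B A
  have h1 : a₁⁻¹ * a ≠ 1 := by
    rw [Ne, inv_mul_eq_one]; exact h.symm
  have hp : PP (X.f b * X.g a) (X.f b₁⁻¹ * X.g (a₁⁻¹ * a)) := by
    apply PP.pair X _ _ _ _ hb (by simpa using hb₁) ha h1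
    · exact fun e => hbb (by rw [e]; simp)
    · simpa using ha₁
  obtain ⟨R, _, F, k, hF, e⟩ := hp.inv_right.main
    (by rw [Ne, inv_eq_one]; exact X.ne_one _ _ h1) c₁ c₂ hc₁ hc₂ hc
  refine ⟨R, _, F.comp X.g, F.comp X.f, (cj (F (X.g a))).comp k,
    hF.comp X.g_inj, ?_⟩
  simp only [MonoidHom.comp_apply, cj_apply]
  simp only [map_mul, map_inv] at e ⊢
  refine rot (F (X.g a)) e ?_
  group

theorem sol_ii1 (a a₂ : A) (b b₁ : B) (c₁ c₂ : C) (ha : a ≠ 1) (ha₂ : a₂ ≠ 1) (hb : b ≠ 1)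
    (hb₁ : b₁ ≠ 1) (hc₁ : c₁ ≠ 1) (hc₂ : c₂ ≠ 1) (hc : c₁ * c₂ ≠ 1) (h : a₂ * a ≠ 1) (hbb : b ≠ b₁) :
    Sol a a a₂ b b₁ c₁ c₂ := by
  obtain ⟨X⟩ := FP.nonempty B A
  have hp : PP (X.f b * X.g a) (X.f b₁ * X.g (a₂ * a)) := by
    apply PP.pair X _ _ _ _ hb hb₁ ha h hbb
    simpa using ha₂
  obtain ⟨R, _, F, k, hF, e⟩ := hp.main (X.ne_one _ _ h) c₁ c₂ hc₁ hc₂ hc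
  refine ⟨R, _, F.comp X.g, F.comp X.f, (cj (F (X.g a))).comp k,
    hF.comp X.g_inj, ?_⟩
  simp only [MonoidHom.comp_apply, cj_apply]
  simp only [map_mul, map_inv] at e ⊢
  refine rot (F (X.g a)) e ?_
  group

theorem sol_ii2 (a a₂ : A) (b b₁ : B) (c₁ c₂ : C) (ha : a ≠ 1) (ha₂ : a₂ ≠ 1) (hb : b ≠ 1)
    (hb₁ : b₁ ≠ 1) (hc₁ : c₁ ≠ 1) (hc₂ : c₂ ≠ 1) (hbb : b * b₁ ≠ 1) (h : a₂ * a ≠ 1) (hc : c₁ ≠ c₂) :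
    Sol a a a₂ b b₁ c₁ c₂ := by
  obtain ⟨R, _, f, g, k, hf, e⟩ := sol_ii1 a⁻¹ a₂⁻¹ c₂⁻¹ c₁⁻¹ b₁⁻¹ b⁻¹ (by simpa using ha)
    (by simpa using ha₂) (by simpa using hc₂) (by simpa using hc₁) (by simpa using hb₁)
    (by simpa using hb) (by rw [← mul_inv_rev, Ne, inv_eq_one]; exact hbb)
    (by
      rw [← mul_inv_rev, Ne, inv_eq_one, mul_eq_one_iff_eq_inv]
      rw [Ne, mul_eq_one_iff_eq_inv] at h
      intro e; exact h (by rw [e, inv_inv]))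
    (by simpa using hc.symm)
  refine ⟨R, _, f, k, g, hf, ?_⟩
  rw [← inv_eq_one]
  simp only [map_inv] at e
  refine rot (f a₂)⁻¹ e ?_
  group

theorem ulift_order {Q : Type} [Group Q] (x : Q) : orderOf (ULift.up.{u} x) = orderOf x :=
  (orderOf_injective (MulEquiv.ulift : ULift.{u} Q ≃* Q).toMonoidHom
    (MulEquiv.ulift : ULift.{u} Q ≃* Q).injective _).symm

theorem order_ne {Q : Type u} [Group Q] {x : Q} (h : x ≠ 1) : orderOf x ≠ 1 := by
  rwa [Ne, orderOf_eq_one_iff]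

theorem sol_ii3 (a a₂ : A) (b : B) (c : C) (hb : b ≠ 1) (hc : c ≠ 1) (h : a * a * a₂ ≠ 1) :
    Sol a a a₂ b b c c := by
  obtain ⟨A', _, i, x, hi, hx⟩ := exists_sqrt a₂⁻¹
  have he : x⁻¹ * i a ≠ 1 := by
    intro e
    rw [inv_mul_eq_one] at e
    rw [e, ← map_mul] at hx
    exact h (by rw [hi hx]; simp)
  obtain ⟨p, q, hp, hq, hpq⟩ := exists_triangle _ _ _ (order_ne he) (order_ne hb) (order_ne hc)
  obtain ⟨R, _, f, g, k, t, hf, e1, e2, e3⟩ := exists_ext3 (x⁻¹ * i a) b c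
    (ULift.up.{u} p) (ULift.up.{u} q) (ULift.up.{u} (p * q))⁻¹ (by rw [ulift_order, hp])
    (by rw [ulift_order, hq]) (by rw [orderOf_inv, ulift_order, hpq])
  have e : k c * f (x⁻¹ * i a) * g b = 1 := by
    rw [e1, e2, e3, ← map_mul, ← map_mul, mul_assoc]
    convert map_one t
    rw [inv_mul_eq_one]; rfl
  have e' : f (i a₂) = (f x * f x)⁻¹ := by
    rw [← map_mul, hx]; simp
  refine ⟨R, _, f.comp i, g, (cj (f x)).comp k, hf.comp hi, ?_⟩
  simp only [MonoidHom.comp_apply, cj_apply]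
  simp only [map_mul, map_inv, e'] at e ⊢
  calc _ = f x * (k c * ((f x)⁻¹ * f (i a)) * g b) * f x * (k c * ((f x)⁻¹ * f (i a)) * g b)
        * (f x * f x)⁻¹ := by group
    _ = 1 := by rw [e]; group

theorem sol_iii1 (a : A) (b b₁ : B) (c₁ c₂ : C) (ha : a ≠ 1)
    (hb₁ : b₁ ≠ 1) (hc₁ : c₁ ≠ 1) (hc₂ : c₂ ≠ 1) (hc : c₁ * c₂ ≠ 1) (h : b ∉ Subgroup.zpowers b₁) :
    Sol a a a⁻¹ b b₁ c₁ c₂ := by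
  obtain ⟨X⟩ := FP.nonempty B A
  obtain ⟨R, _, F, k, hF, e⟩ := (PP.pow X b b₁ a hb₁ ha h).main
    (fun e => hb₁ (X.f_inj (e.trans (map_one _).symm))) c₁ c₂ hc₁ hc₂ hc
  refine ⟨R, _, F.comp X.g, F.comp X.f, (cj (F (X.g a))).comp k,
    hF.comp X.g_inj, ?_⟩
  simp only [MonoidHom.comp_apply, cj_apply]
  simp only [map_mul, map_inv] at e ⊢
  refine rot (F (X.g a)) e ?_
  group

theorem sol_iii2 (a : A) (b b₁ : B) (c₁ c₂ : C) (ha : a ≠ 1)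
    (hb : b ≠ 1) (hb₁ : b₁ ≠ 1) (hc₁ : c₁ ≠ 1) (hbb : b * b₁ ≠ 1) (h : c₂ ∉ Subgroup.zpowers c₁) :
    Sol a a a⁻¹ b b₁ c₁ c₂ := by
  obtain ⟨X⟩ := FP.nonempty C A
  obtain ⟨R, _, F, k, hF, e⟩ := (PP.pow X c₂⁻¹ c₁ a⁻¹ hc₁ (by simpa using ha)
    (by simpa using h)).inv_left.main
    (fun e => hc₁ (X.f_inj (e.trans (map_one _).symm))) b b₁ hb hb₁ hbb
  refine ⟨R, _, F.comp X.g, (cj (F (X.g a))⁻¹).comp k, F.comp X.f,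
    hF.comp X.g_inj, ?_⟩
  simp only [MonoidHom.comp_apply, cj_apply]
  simp only [map_mul, map_inv] at e ⊢
  refine rot (F (X.f c₁)) e ?_
  group

theorem sol_iii3 (a : A) (b : B) (c : C) (k l : ℤ) (ha : a ≠ 1) (hb : b ^ k ≠ 1) (hc : c ^ l ≠ 1) :
    Sol a a a⁻¹ (b ^ k) b c (c ^ l) := by
  have hb0 : b ≠ 1 := by rintro rfl; simp at hb
  have hc0 : c ≠ 1 := by rintro rfl; simp at hc
  obtain ⟨x, y, hx, hy, hxy⟩ := exists_quad _ _ _ (order_ne hb0) (order_ne hc0) (order_ne ha) k l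
    (by rwa [orderOf_dvd_iff_zpow_eq_one]) (by rwa [orderOf_dvd_iff_zpow_eq_one])
  obtain ⟨R, _, f, g, h, t, hf, e1, e2, e3⟩ := exists_ext3 a b c
    (ULift.up.{u} (x ^ k * y ^ l * x * y))⁻¹ (ULift.up.{u} x) (ULift.up.{u} y)
    (by rw [orderOf_inv, ulift_order, hxy])
    (by rw [ulift_order, hx]) (by rw [ulift_order, hy])
  have e : f a = (g b ^ k * h c ^ l * g b * h c)⁻¹ := by
    rw [e1, e2, e3, ← map_zpow, ← map_zpow, ← map_mul, ← map_mul, ← map_mul, ← map_inv]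
    rfl
  refine ⟨R, _, (cj (g b ^ k)⁻¹).comp f,
    (cj ((g b ^ k)⁻¹ * f a * g b ^ k)⁻¹).comp g, h,
    (cj_inj _).comp hf, ?_⟩
  simp only [MonoidHom.comp_apply, cj_apply]
  simp only [map_mul, map_inv,
    map_zpow, e]
  group

theorem sol_main (a a₁ a₂ : A) (b b₁ : B) (c₁ c₂ : C) (ha : a ≠ 1) (ha₁ : a₁ ≠ 1) (ha₂ : a₂ ≠ 1)
    (hb : b ≠ 1) (hb₁ : b₁ ≠ 1) (hc₁ : c₁ ≠ 1) (hc₂ : c₂ ≠ 1) (hc : c₁ * c₂ ≠ 1)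
    (hbb : b * b₁ ≠ 1) (haa : a * a₁ * a₂ ≠ 1) :
    Sol a a₁ a₂ b b₁ c₁ c₂ := by
  by_cases h : a = a₁
  · subst h
    by_cases h1 : a₂ * a = 1
    · obtain rfl : a₂ = a⁻¹ := mul_eq_one_iff_eq_inv.1 h1
      by_cases h2 : b ∈ Subgroup.zpowers b₁
      · by_cases h3 : c₂ ∈ Subgroup.zpowers c₁
        · obtain ⟨k, rfl⟩ := h2
          obtain ⟨l, rfl⟩ := h3
          exact sol_iii3 a b₁ c₁ k l ha hb hc₂
        · exact sol_iii2 a b b₁ c₁ c₂ ha hb hb₁ hc₁ hbb h3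
      · exact sol_iii1 a b b₁ c₁ c₂ ha hb₁ hc₁ hc₂ hc h2
    · by_cases h2 : b = b₁
      · by_cases h3 : c₁ = c₂
        · subst h2 h3
          exact sol_ii3 a a₂ b c₁ hb hc₁ haa
        · exact sol_ii2 a a₂ b b₁ c₁ c₂ ha ha₂ hb hb₁ hc₁ hc₂ hbb h1 h3
      · exact sol_ii1 a a₂ b b₁ c₁ c₂ ha ha₂ hb hb₁ hc₁ hc₂ hc h1 h2
  · by_cases h1 : a₁ = a₂⁻¹
    · obtain rfl : a₂ = a₁⁻¹ := by rw [h1, inv_inv]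
      exact sol_i1 a a₁ b b₁ c₁ c₂ ha ha₁ hb hb₁ hc₁ hc₂ hc hbb h
    · by_cases h2 : a = a₂⁻¹
      · obtain rfl : a₂ = a⁻¹ := by rw [h2, inv_inv]
        exact sol_i3 a a₁ b b₁ c₁ c₂ ha ha₁ hb hb₁ hc₁ hc₂ hc hbb h
      · exact sol_i2 a a₁ a₂ b b₁ c₁ c₂ ha ha₁ ha₂ hb hb₁ hc₁ hc₂ hc h h2 h1

end cases

theorem final_aux {G : Fin 3 → Type u} [∀ i, Group (G i)] {R : Type u} [Group R] (f : G 0 →* R)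
    (g : G 1 →* R) (h : G 2 →* R) (a : G 0) (ha : f a ≠ 1) (w : Monoid.CoprodI G)
    (hw : ∀ F : Monoid.CoprodI G →* R, (∀ x, F (Monoid.CoprodI.of x) = f x) →
      (∀ x, F (Monoid.CoprodI.of x) = g x) → (∀ x, F (Monoid.CoprodI.of x) = h x) → F w = 1) :
    Nontrivial (Monoid.CoprodI G ⧸ Subgroup.normalClosure {w}) := by
  let φ : ∀ i, G i →* R := fun i => match i with
    | 0 => f
    | 1 => g
    | 2 => h
  let F := Monoid.CoprodI.lift φ
  have h0 : ∀ x : G 0, F (Monoid.CoprodI.of x) = f x := fun x => Monoid.CoprodI.lift_of φ x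
  have hF : F w = 1 := hw F h0 (fun x => Monoid.CoprodI.lift_of φ x)
    (fun x => Monoid.CoprodI.lift_of φ x)
  refine ⟨⟨QuotientGroup.mk (Monoid.CoprodI.of a), 1, ?_⟩⟩
  intro e
  rw [QuotientGroup.eq_one_iff] at e
  have hle : Subgroup.normalClosure {w} ≤ F.ker :=
    Subgroup.normalClosure_le_normal (by simpa using hF)
  have := hle e
  rw [MonoidHom.mem_ker, h0] at this
  exact ha this

end P57

/-- **Proposition 5.7 (Chinyere–Howie).** Standing assumptions as in Lemma 5.3.  If
`U = αβ` or `U = (αβ)⁻¹` and `V = α₁β₁α₂`, with `α, α₁, α₂` nontrivial in `A`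
and `β, β₁` nontrivial in `B`, then `G` is nontrivial. -/
theorem prop_5_7
    {G : Fin 3 → Type*} [∀ i, Group (G i)] [∀ i, Nontrivial (G i)]
    (c₁ c₂ : G 2) (hc₁ : c₁ ≠ 1) (hc₂ : c₂ ≠ 1) (hc₁c₂ : c₁ * c₂ ≠ 1)
    (U V : Monoid.CoprodI (subFamily G))
    (hlen : CoprodI.length U + CoprodI.length V ≤ 6)
    (hUVA : U * V ∉ Subgroup.normalClosure
      (Set.range (Monoid.CoprodI.of : subFamily G 0 →* Monoid.CoprodI (subFamily G))))
    (hUVB : U * V ∉ Subgroup.normalClosure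
      (Set.range (Monoid.CoprodI.of : subFamily G 1 →* Monoid.CoprodI (subFamily G))))
    (α α₁ α₂ : subFamily G 0) (β β₁ : subFamily G 1)
    (hα : α ≠ 1) (hα₁ : α₁ ≠ 1) (hα₂ : α₂ ≠ 1) (hβ : β ≠ 1) (hβ₁ : β₁ ≠ 1)
    (hU : U = (Monoid.CoprodI.of : subFamily G 0 →* Monoid.CoprodI (subFamily G)) α * (Monoid.CoprodI.of : subFamily G 1 →* Monoid.CoprodI (subFamily G)) β ∨
      U = ((Monoid.CoprodI.of : subFamily G 0 →* Monoid.CoprodI (subFamily G)) α * (Monoid.CoprodI.of : subFamily G 1 →* Monoid.CoprodI (subFamily G)) β)⁻¹)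
    (hV : V = (Monoid.CoprodI.of : subFamily G 0 →* Monoid.CoprodI (subFamily G)) α₁ * (Monoid.CoprodI.of : subFamily G 1 →* Monoid.CoprodI (subFamily G)) β₁ * (Monoid.CoprodI.of : subFamily G 0 →* Monoid.CoprodI (subFamily G)) α₂)
    :
    Nontrivial (Monoid.CoprodI G ⧸ Subgroup.normalClosure
      {(Monoid.CoprodI.of : G 2 →* Monoid.CoprodI G) c₁ * CoprodI.embed G U *
        (Monoid.CoprodI.of : G 2 →* Monoid.CoprodI G) c₂ * CoprodI.embed G V}) := by
  have key : ∀ (R : Type _) (_ : Group R) (f : subFamily G 0 →* R) (g : subFamily G 1 →* R) (h : G 2 →* R),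
      f α ≠ 1 → ∀ u : R, (∀ L : Monoid.CoprodI (subFamily G) →* R,
        (∀ x : subFamily G 0, L (Monoid.CoprodI.of x) = f x) →
        (∀ x : subFamily G 1, L (Monoid.CoprodI.of x) = g x) → L U = u) →
      h c₁ * u * h c₂ * (f α₁ * g β₁ * f α₂) = 1 →
      Nontrivial (Monoid.CoprodI G ⧸ Subgroup.normalClosure
      {(Monoid.CoprodI.of : G 2 →* Monoid.CoprodI G) c₁ * CoprodI.embed G U *
        (Monoid.CoprodI.of : G 2 →* Monoid.CoprodI G) c₂ * CoprodI.embed G V}) := by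
    intro R _ f g h hfa u hu H
    refine P57.final_aux (G := G) f g h α hfa _ ?_
    intro F hF0 hF1 hF2
    have e0 : ∀ x : subFamily G 0, F (CoprodI.embed G (Monoid.CoprodI.of x)) = f x := by
      intro x
      refine Eq.trans (congrArg F ?_) (hF0 x)
      exact Monoid.CoprodI.lift_of (M := subFamily G)
        (fun i => (Monoid.CoprodI.of : G i.castSucc →* Monoid.CoprodI G)) x
    have e1 : ∀ x : subFamily G 1, F (CoprodI.embed G (Monoid.CoprodI.of x)) = g x := by
      intro x
      refine Eq.trans (congrArg F ?_) (hF1 x)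
      exact Monoid.CoprodI.lift_of (M := subFamily G)
        (fun i => (Monoid.CoprodI.of : G i.castSucc →* Monoid.CoprodI G)) x
    have eU : F (CoprodI.embed G U) = u := hu (F.comp (CoprodI.embed G)) e0 e1
    rw [map_mul, map_mul, map_mul, hF2, hF2, eU, ← H, hV, map_mul, map_mul, map_mul, map_mul,
      e0, e0, e1]
  have hA : ∀ x, (Monoid.CoprodI.of : subFamily G 0 →* Monoid.CoprodI (subFamily G)) x ∈
      Subgroup.normalClosure (Set.range (Monoid.CoprodI.of : subFamily G 0 →* Monoid.CoprodI (subFamily G))) :=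
    fun x => Subgroup.subset_normalClosure ⟨x, rfl⟩
  have hB : ∀ x, (Monoid.CoprodI.of : subFamily G 1 →* Monoid.CoprodI (subFamily G)) x ∈
      Subgroup.normalClosure (Set.range (Monoid.CoprodI.of : subFamily G 1 →* Monoid.CoprodI (subFamily G))) :=
    fun x => Subgroup.subset_normalClosure ⟨x, rfl⟩
  rw [← QuotientGroup.eq_one_iff] at hUVA hUVB
  simp only [← QuotientGroup.eq_one_iff] at hA hB
  rcases hU with hU | hU
  · have hbb : β * β₁ ≠ 1 := by
      intro e
      apply hUVA
      rw [hU, hV]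
      simp only [QuotientGroup.mk_mul, hA, one_mul, mul_one]
      rw [← QuotientGroup.mk_mul, ← map_mul, e, map_one, QuotientGroup.mk_one]
    have haa : α * α₁ * α₂ ≠ 1 := by
      intro e
      apply hUVB
      rw [hU, hV]
      simp only [QuotientGroup.mk_mul, hB, one_mul, mul_one]
      rw [← QuotientGroup.mk_mul, ← QuotientGroup.mk_mul, ← map_mul, ← map_mul, ← mul_assoc, e,
        map_one, QuotientGroup.mk_one]
    obtain ⟨R, _, f, g, h, hf, e⟩ := P57.sol_main (A := subFamily G 0) (B := subFamily G 1) (C := G 2) α α₁ α₂ β β₁ c₁ c₂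
      hα hα₁ hα₂ hβ hβ₁ hc₁ hc₂ hc₁c₂ hbb haa
    refine key R _ f g h (fun e => hα (hf (e.trans (map_one f).symm))) (f α * g β) ?_ ?_
    · intro L h0 h1
      rw [hU, map_mul, h0, h1]
    · simpa only [mul_assoc] using e
  · have hbb : β * β₁⁻¹ ≠ 1 := by
      intro e
      apply hUVA
      rw [hU, hV]
      simp only [QuotientGroup.mk_mul, QuotientGroup.mk_inv, hA, one_mul, mul_one]
      rw [← QuotientGroup.mk_inv, ← QuotientGroup.mk_mul, ← map_inv, ← map_mul,
        mul_inv_eq_one.1 e, inv_mul_cancel, map_one, QuotientGroup.mk_one]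
    have haa : α * α₂⁻¹ * α₁⁻¹ ≠ 1 := by
      intro e
      have e' : α = α₁ * α₂ := by
        rw [mul_inv_eq_one, mul_inv_eq_iff_eq_mul] at e
        exact e
      apply hUVB
      rw [hU, hV]
      simp only [QuotientGroup.mk_mul, QuotientGroup.mk_inv, hB, one_mul, mul_one]
      rw [← QuotientGroup.mk_inv, ← QuotientGroup.mk_mul, ← QuotientGroup.mk_mul, ← map_inv,
        ← map_mul, ← map_mul, e', inv_mul_cancel, map_one, QuotientGroup.mk_one]
    obtain ⟨R, _, f, g, h, hf, e⟩ := P57.sol_main (A := subFamily G 0) (B := subFamily G 1) (C := G 2) α α₂⁻¹ α₁⁻¹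
      β β₁⁻¹ c₂⁻¹ c₁⁻¹ hα (inv_ne_one.2 hα₂) (inv_ne_one.2 hα₁) hβ (inv_ne_one.2 hβ₁)
      (inv_ne_one.2 hc₂) (inv_ne_one.2 hc₁) (by rw [← mul_inv_rev]; exact inv_ne_one.2 hc₁c₂) hbb haa
    refine key R _ f g h (fun e => hα (hf (e.trans (map_one f).symm))) (f α * g β)⁻¹ ?_ ?_
    · intro L h0 h1
      rw [hU, map_inv, map_mul, h0, h1]
    · rw [← inv_eq_one]
      simp only [map_inv] at e
      refine P57.rot ((f α₂)⁻¹ * (g β₁)⁻¹ * (f α₁)⁻¹) e ?_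
      group
end
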